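/- arXiv:2110.03033 — 10 statements merged into one kernel-verified Lean document; each statement's English description precedes it below -/
import Mathlib

section
/- Let P ⊆ ℝ^d be a nondegenerate compact strictly convex set. Then there exists δ > 0 such that for every x ∈ ∂P, every segment ℓ maximal with respect to P having x as an endpoint, and every supporting hyperplane H of P at x, one has |u_ℓ · n_H| ≥ δ. -/
open Pointwise Filter Topology Set RealInnerProductSpace

/-- The segment `[x, y]` is *maximal* with respect to `P`: it is contained in `P` and no
translated enlarged copy `z + s • [x, y]` with `s > 1` is contained in `P`. -/
def IsMaxSeg {d : ℕ} (P : Set (EuclideanSpace ℝ (Fin d))) (x y : EuclideanSpace ℝ (Fin d)) :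
    Prop :=
  segment ℝ x y ⊆ P ∧
    ¬∃ (z : EuclideanSpace ℝ (Fin d)) (s : ℝ), 1 < s ∧ z +ᵥ s • segment ℝ x y ⊆ P

open RealInnerProductSpace in
/-- The hyperplane `{z | ⟪a, z⟫ = b}`, with unit normal `a`, is a supporting hyperplane of
`P` at `x`: it contains `x` and `P` lies in one of the two closed half-spaces bounded by it. -/
def IsSuppHyperplaneAt {d : ℕ} (P : Set (EuclideanSpace ℝ (Fin d)))
    (x a : EuclideanSpace ℝ (Fin d)) (b : ℝ) : Prop :=
  ‖a‖ = 1 ∧ ⟪a, x⟫ = b ∧ ∀ z ∈ P, ⟪a, z⟫ ≤ b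

/-- **Lemma.** Let `P ⊆ ℝ^d` be a nondegenerate compact strictly convex set.  Then there is
`δ > 0` such that for every `x ∈ ∂P`, every segment `ℓ` maximal with respect to `P` with
endpoint `x`, and every supporting hyperplane `H` of `P` at `x`, `|u_ℓ ⬝ n_H| ≥ δ`. -/
theorem deltaP_pos_of_strictConvex (d : ℕ) (P : Set (EuclideanSpace ℝ (Fin d)))
    (hPcomp : IsCompact P) (hPsc : StrictConvex ℝ P) (hPnd : P.Nontrivial) :
    ∃ δ : ℝ, 0 < δ ∧ ∀ x ∈ frontier P, ∀ y : EuclideanSpace ℝ (Fin d), IsMaxSeg P x y →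
      ∀ (a : EuclideanSpace ℝ (Fin d)) (b : ℝ), IsSuppHyperplaneAt P x a b →
        δ ≤ |⟪‖y - x‖⁻¹ • (y - x), a⟫| := by
  obtain ⟨p, hp, q, hq, hpq⟩ := hPnd
  have hc := hPsc hp hq hpq (show (0:ℝ) < 1/2 by norm_num) (show (0:ℝ) < 1/2 by norm_num)
    (by norm_num)
  set c := (1/2:ℝ) • p + (1/2:ℝ) • q with hcdef
  obtain ⟨r, hr, hball⟩ := Metric.isOpen_iff.1 isOpen_interior c hc
  -- length bound
  have hlen : ∀ x y, IsMaxSeg P x y → r / 2 ≤ ‖y - x‖ := by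
    intro x y h
    by_contra! hlt
    apply h.2
    refine ⟨c - (2:ℝ) • x, 2, by norm_num, ?_⟩
    rintro _ ⟨_, ⟨w, hw, rfl⟩, rfl⟩
    rw [segment_eq_image'] at hw
    obtain ⟨t, ht, rfl⟩ := hw
    apply interior_subset
    apply hball
    have : ((c - (2:ℝ) • x) +ᵥ (2:ℝ) • (x + t • (y - x))) - c = (2 * t) • (y - x) := by
      simp only [vadd_eq_add]
      module
    rw [Metric.mem_ball, dist_eq_norm]
    show ‖((c - (2:ℝ) • x) +ᵥ (2:ℝ) • (x + t • (y - x))) - c‖ < r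
    rw [this, norm_smul, Real.norm_eq_abs, abs_of_nonneg (by linarith [ht.1])]
    nlinarith [ht.1, ht.2, norm_nonneg (y - x)]
  let E := EuclideanSpace ℝ (Fin d)
  let K : Set (E × E × E) := (P ×ˢ P ×ˢ Metric.sphere (0:E) 1) ∩
    ({v | r / 2 ≤ ‖v.2.1 - v.1‖} ∩ {v | ∀ z ∈ P, ⟪v.2.2, z⟫ ≤ ⟪v.2.2, v.1⟫})
  have hK : IsCompact K := by
    refine (hPcomp.prod (hPcomp.prod (isCompact_sphere _ _))).inter_right (IsClosed.inter ?_ ?_)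
    · exact isClosed_le (by fun_prop) (by fun_prop)
    · simp only [Set.ofPred_forall]
      refine isClosed_iInter fun z => isClosed_iInter fun _ => ?_
      exact isClosed_le (by fun_prop) (by fun_prop)
  have hpos : ∀ v ∈ K, 0 < |⟪v.2.1 - v.1, v.2.2⟫| := by
    rintro ⟨x, y, a⟩ ⟨⟨hx, hy, ha⟩, hxy, hs⟩
    simp only [mem_ofPred_eq, mem_sphere_zero_iff_norm] at hx hy ha hxy hs ⊢
    rw [abs_pos]
    intro h0
    have hne : x ≠ y := by
      rintro rfl
      simp at hxy
      linarith
    have hm := hPsc hx hy hne (show (0:ℝ) < 1/2 by norm_num) (show (0:ℝ) < 1/2 by norm_num)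
      (by norm_num)
    obtain ⟨e, he, hb⟩ := Metric.isOpen_iff.1 isOpen_interior _ hm
    have hmem : (1/2:ℝ) • x + (1/2:ℝ) • y + (e/2) • a ∈ P := by
      apply interior_subset
      apply hb
      rw [Metric.mem_ball, dist_eq_norm, add_sub_cancel_left, norm_smul, ha, Real.norm_eq_abs,
        abs_of_pos (by linarith)]
      linarith
    have := hs _ hmem
    rw [inner_sub_left, real_inner_comm, real_inner_comm a x] at h0
    simp only [inner_add_right, inner_smul_right, real_inner_self_eq_norm_sq, ha] at this
    linarith
  obtain ⟨m, hm0, hm⟩ : ∃ m : ℝ, 0 < m ∧ ∀ v ∈ K, m ≤ |⟪v.2.1 - v.1, v.2.2⟫| := by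
    rcases K.eq_empty_or_nonempty with h | h
    · exact ⟨1, one_pos, by simp [h]⟩
    · obtain ⟨v, hv, hmin⟩ := hK.exists_isMinOn h
        (f := fun v : E × E × E => |⟪v.2.1 - v.1, v.2.2⟫|) (by fun_prop)
      exact ⟨_, hpos v hv, fun w hw => hmin hw⟩
  obtain ⟨D, hD⟩ := hPcomp.isBounded.exists_norm_le
  have hD0 : 0 ≤ D := (norm_nonneg p).trans (hD p hp)
  refine ⟨m / (2 * D + 1), by positivity, ?_⟩
  intro x _ y hmax a b ⟨ha, hb, hs⟩
  have hx : x ∈ P := hmax.1 (left_mem_segment ℝ x y)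
  have hy : y ∈ P := hmax.1 (right_mem_segment ℝ x y)
  have hl := hlen x y hmax
  have hk := hm (x, y, a) ⟨⟨hx, hy, by simpa using ha⟩, hl, fun z hz => by
    simpa [hb] using hs z hz⟩
  have hn : ‖y - x‖ ≤ 2 * D + 1 := by
    linarith [norm_sub_le y x, hD x hx, hD y hy]
  have hn0 : 0 < ‖y - x‖ := by linarith
  rw [real_inner_smul_left, abs_mul, abs_of_pos (inv_pos.2 hn0), inv_mul_eq_div]
  simp only at hk
  gcongr
end

section
/- (Cone Lemma) Let A ⊆ ℝ^d be uncountable and let a_1, …, a_k ∈ ℝ^d be nonzero vectors. For a sign vector p ∈ {−1, 1}^k let C(p) = {z ∈ ℝ^d : p_i ⟨a_i, z⟩ ≥ 0 for all i ≤ k}. Then there exist a sign vector p ∈ {−1, 1}^k and an uncountable subset A' ⊆ A such that every x ∈ A' is a strong limit point of A' ∩ (x + C(p)) and also a strong limit point of A' ∩ (x + C(−p)), where −p denotes the pointwise negation of p. -/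
open Filter Topology Set RealInnerProductSpace

/-- `x` is a strong limit point of `S`: every neighborhood of `x` contains uncountably many
points of `S`. -/
def StrongLimitPt {X : Type*} [TopologicalSpace X] (S : Set X) (x : X) : Prop :=
  ∀ U ∈ 𝓝 x, ¬(U ∩ S).Countable


section ConeAux

variable {X : Type*} {k : ℕ}

/-- weak cone at `x` -/
def coneW (f : Fin k → X → ℝ) (p : Fin k → ℝ) (x : X) : Set X :=
  {y | ∀ i, 0 ≤ p i * (f i y - f i x)}

lemma cone_maximal (f : Fin k → X → ℝ) (A : Set X) (hA : ¬A.Countable) :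
    ∃ (I : Finset (Fin k)) (B : Set X), B ⊆ A ∧ ¬B.Countable ∧
      (∀ i ∈ I, ∀ x ∈ B, ∀ y ∈ B, f i x = f i y) ∧
      (∀ i ∉ I, ∀ c, (B ∩ {y | f i y = c}).Countable) := by
  classical
  let T : Set (Finset (Fin k)) := {I | ∃ B : Set X, B ⊆ A ∧ ¬B.Countable ∧
      (∀ i ∈ I, ∀ x ∈ B, ∀ y ∈ B, f i x = f i y)}
  have hT : T.Nonempty := ⟨∅, A, subset_rfl, hA, by simp⟩
  obtain ⟨I, hI⟩ := (Set.toFinite T).exists_maximal hT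
  obtain ⟨B, hBA, hB, hc⟩ := hI.prop
  refine ⟨I, B, hBA, hB, hc, ?_⟩
  intro i hi c
  by_contra hcon
  have hmem : insert i I ∈ T := by
    refine ⟨B ∩ {y | f i y = c}, fun x hx => hBA hx.1, hcon, ?_⟩
    intro j hj x hx y hy
    rcases Finset.mem_insert.1 hj with rfl | hj
    · exact hx.2.trans hy.2.symm
    · exact hc j hj x hx.1 y hy.1
  exact hi (hI.le_of_ge hmem (Finset.subset_insert i I) (Finset.mem_insert_self i I))

lemma cone_bad [TopologicalSpace X] [SecondCountableTopology X] (W : X → Set X) (D E : Set X)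
    (hED : E ⊆ D) (hE : ¬E.Countable) (h : ∀ x ∈ E, ¬StrongLimitPt (D ∩ W x) x) :
    ∃ F ⊆ D, ¬F.Countable ∧ ∀ x ∈ F, (F ∩ W x).Countable := by
  let b := TopologicalSpace.countableBasis X
  have hb := TopologicalSpace.isBasis_countableBasis X
  have hbc := TopologicalSpace.countable_countableBasis X
  by_contra hcon
  push Not at hcon
  apply hE
  have : E ⊆ ⋃ U ∈ b, {x ∈ E | x ∈ U ∧ (U ∩ (D ∩ W x)).Countable} := by
    intro x hx
    have := h x hx
    unfold StrongLimitPt at this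
    push Not at this
    obtain ⟨V, hV, hVc⟩ := this
    obtain ⟨U, hU, hxU, hUV⟩ := hb.mem_nhds_iff.1 hV
    simp only [mem_iUnion]
    exact ⟨U, hU, hx, hxU, hVc.mono (inter_subset_inter_left _ hUV)⟩
  refine Countable.mono this (hbc.biUnion ?_)
  intro U hU
  by_contra hnc
  obtain ⟨x, hx, hxc⟩ := hcon _ (fun x hx => hED hx.1) hnc
  apply hxc
  refine Set.Countable.mono ?_ hx.2.2
  intro y hy
  exact ⟨hy.1.2.1, hED hy.1.1, hy.2⟩

lemma cone_step1 [TopologicalSpace X] [SecondCountableTopology X] (W W' : X → Set X)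
    (D : Set X) (hD : ¬D.Countable)
    (h : ¬ ∃ A' ⊆ D, ¬A'.Countable ∧ ∀ x ∈ A',
      StrongLimitPt (A' ∩ W x) x ∧ StrongLimitPt (A' ∩ W' x) x) :
    ∃ F ⊆ D, ¬F.Countable ∧ ((∀ x ∈ F, (F ∩ W x).Countable) ∨
      (∀ x ∈ F, (F ∩ W' x).Countable)) := by
  by_cases h1 : {x ∈ D | ¬StrongLimitPt (D ∩ W x) x}.Countable
  swap
  · obtain ⟨F, a, b, c⟩ := cone_bad W D _ (fun x hx => hx.1) h1 (fun x hx => hx.2)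
    exact ⟨F, a, b, Or.inl c⟩
  by_cases h2 : {x ∈ D | ¬StrongLimitPt (D ∩ W' x) x}.Countable
  swap
  · obtain ⟨F, a, b, c⟩ := cone_bad W' D _ (fun x hx => hx.1) h2 (fun x hx => hx.2)
    exact ⟨F, a, b, Or.inr c⟩
  exfalso
  apply h
  have hN := h1.union h2
  set N := {x ∈ D | ¬StrongLimitPt (D ∩ W x) x} ∪ {x ∈ D | ¬StrongLimitPt (D ∩ W' x) x} with hNd
  have key : ∀ V : Set X, ∀ x, StrongLimitPt (D ∩ V) x → StrongLimitPt ((D \ N) ∩ V) x := by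
    intro V x hx U hU hc
    apply hx U hU
    refine (hc.union hN).mono ?_
    intro y hy
    by_cases hyN : y ∈ N
    · exact Or.inr hyN
    · exact Or.inl ⟨hy.1, ⟨hy.2.1, hyN⟩, hy.2.2⟩
  refine ⟨D \ N, sdiff_subset, ?_, ?_⟩
  · intro hc
    apply hD
    refine (hc.union hN).mono ?_
    intro y hy
    by_cases hyN : y ∈ N
    · exact Or.inr hyN
    · exact Or.inl ⟨hy, hyN⟩
  · intro x hx
    constructor
    · apply key
      by_contra hcon
      exact hx.2 (Or.inl ⟨hx.1, hcon⟩)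
    · apply key
      by_contra hcon
      exact hx.2 (Or.inr ⟨hx.1, hcon⟩)

lemma cone_step2 [TopologicalSpace X] [SecondCountableTopology X] (f : Fin k → X → ℝ)
    (hf : ∀ i, Continuous (f i)) (I : Finset (Fin k)) (E : Set X)
    (hI : ∀ i ∈ I, ∀ x ∈ E, ∀ y ∈ E, f i x = f i y)
    (hN : ∀ i ∉ I, ∀ c, (E ∩ {y | f i y = c}).Countable)
    (p q : Fin k → ℝ) (hp : ∀ i, p i ≠ 0) (hq : ∀ i, q i = - p i) (hE : ¬E.Countable)
    (h : ∀ x ∈ E, (E ∩ coneW f p x).Countable) :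
    ∃ F ⊆ E, ¬F.Countable ∧ (∀ x ∈ F, (F ∩ coneW f p x).Countable) ∧
      (∀ x ∈ F, (F ∩ coneW f q x).Countable) := by
  obtain ⟨Q, hQc, hQd⟩ := TopologicalSpace.exists_countable_dense E
  set M : Set X := ⋃ z ∈ Q, (E ∩ coneW f p z.1) with hM
  have hMc : M.Countable := hQc.biUnion (fun z _ => h z.1 z.2)
  refine ⟨E \ M, sdiff_subset, ?_, ?_, ?_⟩
  · intro hc
    apply hE
    refine (hc.union hMc).mono ?_
    intro y hy
    by_cases hyN : y ∈ M
    · exact Or.inr hyN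
    · exact Or.inl ⟨hy, hyN⟩
  · intro x hx
    exact (h x hx.1).mono (inter_subset_inter_left _ sdiff_subset)
  · intro x hx
    have hc : (⋃ i : Fin k, ⋃ _ : i ∉ I, (E ∩ {y | f i y = f i x})).Countable :=
      countable_iUnion fun i => countable_iUnion fun hi => hN i hi _
    refine hc.mono ?_
    intro y hy
    by_contra hcon
    simp only [mem_iUnion, not_exists] at hcon
    have hO : IsOpen {z : E | ∀ i, i ∉ I → 0 < q i * (f i z.1 - f i x)} := by
      simp only [ofPred_forall]
      refine isOpen_iInter_of_finite fun i => isOpen_iInter_of_finite fun hi => ?_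
      exact isOpen_lt continuous_const
        (continuous_const.mul (((hf i).comp continuous_subtype_val).sub continuous_const))
    have hne : {z : E | ∀ i, i ∉ I → 0 < q i * (f i z.1 - f i x)}.Nonempty := by
      refine ⟨⟨y, hy.1.1⟩, ?_⟩
      intro i hi
      refine lt_of_le_of_ne (hy.2 i) (Ne.symm ?_)
      refine mul_ne_zero ?_ ?_
      · rw [hq]; exact neg_ne_zero.2 (hp i)
      · intro h0
        exact hcon i hi ⟨hy.1.1, sub_eq_zero.1 h0⟩
    obtain ⟨z, hz, hzQ⟩ := hQd.inter_open_nonempty _ hO hne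
    apply hx.2
    rw [hM]
    simp only [mem_iUnion]
    refine ⟨z, hzQ, hx.1, ?_⟩
    intro i
    by_cases hi : i ∈ I
    · rw [hI i hi x hx.1 z.1 z.2]; simp
    · have := hz i hi
      rw [hq] at this
      nlinarith

lemma cone_main [TopologicalSpace X] [SecondCountableTopology X] (f : Fin k → X → ℝ)
    (hf : ∀ i, Continuous (f i)) (A : Set X) (hA : ¬A.Countable) :
    ∃ p : Fin k → ℝ, (∀ i, p i = 1 ∨ p i = -1) ∧
      ∃ A' ⊆ A, ¬A'.Countable ∧ ∀ x ∈ A',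
        StrongLimitPt (A' ∩ coneW f p x) x ∧
        StrongLimitPt (A' ∩ coneW f (fun i => - p i) x) x := by
  classical
  obtain ⟨I, B, hBA, hB, hI, hN⟩ := cone_maximal f A hA
  by_contra hcon
  let s : (Fin k → Bool) → Fin k → ℝ := fun b i => if b i then 1 else -1
  have hs : ∀ b i, s b i = 1 ∨ s b i = -1 := by
    intro b i
    by_cases h : b i <;> simp [s, h]
  have hs0 : ∀ b i, s b i ≠ 0 := by
    intro b i
    rcases hs b i with h | h <;> rw [h] <;> norm_num
  have key : ∀ S : Finset (Fin k → Bool), ∃ D ⊆ B, ¬D.Countable ∧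
      ∀ b ∈ S, ∀ x ∈ D, (D ∩ coneW f (s b) x).Countable := by
    intro S
    induction S using Finset.induction_on with
    | empty => exact ⟨B, subset_rfl, hB, by simp⟩
    | insert b S _ ih =>
      obtain ⟨D, hDB, hD, hDS⟩ := ih
      obtain ⟨F, hFD, hF, hor⟩ := cone_step1 (coneW f (s b)) (coneW f (fun i => - s b i)) D hD
        (fun ⟨A', h1, h2⟩ => hcon ⟨s b, hs b, A', h1.trans (hDB.trans hBA), h2⟩)
      have hFB := hFD.trans hDB
      have hIF : ∀ i ∈ I, ∀ x ∈ F, ∀ y ∈ F, f i x = f i y :=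
        fun i hi x hx y hy => hI i hi x (hFB hx) y (hFB hy)
      have hNF : ∀ i ∉ I, ∀ c, (F ∩ {y | f i y = c}).Countable :=
        fun i hi c => (hN i hi c).mono (inter_subset_inter_left _ hFB)
      have : ∃ G ⊆ F, ¬G.Countable ∧ (∀ x ∈ G, (G ∩ coneW f (s b) x).Countable) := by
        rcases hor with h | h
        · exact ⟨F, subset_rfl, hF, h⟩
        · obtain ⟨G, h1, h2, _, h4⟩ := cone_step2 f hf I F hIF hNF (fun i => - s b i) (s b)
            (fun i => neg_ne_zero.2 (hs0 b i)) (fun i => (neg_neg _).symm) hF h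
          exact ⟨G, h1, h2, h4⟩
      obtain ⟨G, hGF, hG, hGc⟩ := this
      refine ⟨G, hGF.trans hFB, hG, ?_⟩
      intro c hc x hx
      rcases Finset.mem_insert.1 hc with rfl | hc
      · exact hGc x hx
      · exact (hDS c hc x (hFD (hGF hx))).mono (inter_subset_inter_left _ (hGF.trans hFD))
  obtain ⟨D, _, hD, hDc⟩ := key Finset.univ
  have hne : D.Nonempty := by
    by_contra h
    rw [not_nonempty_iff_eq_empty] at h
    exact hD (h ▸ countable_empty)
  obtain ⟨x, hx⟩ := hne
  apply hD
  refine (countable_iUnion fun b => hDc b (Finset.mem_univ b) x hx).mono ?_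
  intro y hy
  refine mem_iUnion.2 ⟨fun i => decide (f i x ≤ f i y), hy, ?_⟩
  intro i
  by_cases h : f i x ≤ f i y
  · simp [s, h]
  · simp only [s, h, decide_false]
    push Not at h
    simp
    exact h.le

end ConeAux

/-- **Cone Lemma.** Let `A ⊆ ℝ^d` be uncountable and let `a₁, …, a_k` be nonzero vectors.
For a sign vector `p ∈ {−1,1}^k` let `C(p) = {z | pᵢ ⟪aᵢ, z⟫ ≥ 0 for all i}`.  Then there
are a sign vector `p` and an uncountable `A' ⊆ A` such that every `x ∈ A'` is a strong limit
point of `A' ∩ (x + C(p))` and of `A' ∩ (x + C(−p))`. -/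
theorem cone_lemma (d k : ℕ) (A : Set (EuclideanSpace ℝ (Fin d))) (hA : ¬A.Countable)
    (a : Fin k → EuclideanSpace ℝ (Fin d)) (ha : ∀ i, a i ≠ 0) :
    ∃ p : Fin k → ℝ, (∀ i, p i = 1 ∨ p i = -1) ∧
      ∃ A' ⊆ A, ¬A'.Countable ∧ ∀ x ∈ A',
        StrongLimitPt (A' ∩ {z | ∀ i, 0 ≤ p i * ⟪a i, z - x⟫}) x ∧
        StrongLimitPt (A' ∩ {z | ∀ i, 0 ≤ -p i * ⟪a i, z - x⟫}) x := by
  obtain ⟨p, hp, A', h1, h2, h3⟩ := cone_main (fun i z => (⟪a i, z⟫ : ℝ))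
    (fun i => continuous_const.inner continuous_id) A hA
  refine ⟨p, hp, A', h1, h2, fun x hx => ?_⟩
  have := h3 x hx
  simp only [coneW, ← inner_sub_right] at this
  exact this
end

section
/- Let X be a second countable topological space, let A ⊆ X be uncountable, let n ≥ 1, and let c : X → X → {1, …, n} be a symmetric function (a coloring of unordered pairs by n colors). Then there exist an uncountable B ⊆ A and a color i ≤ n such that B is partially homogeneous for i: for every x ∈ B, x is a strong limit point of the set {y ∈ B : y ≠ x and c(x, y) = i}. -/
open Filter Topology Set

theorem indep_aux {X : Type*} (A : Set X) (hA : ¬A.Countable) (R : X → X → Prop)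
    (hs : ∀ x y, R x y → R y x) (hR : ∀ x ∈ A, {y | y ∈ A ∧ R x y}.Countable) :
    ∃ B ⊆ A, ¬B.Countable ∧ ∀ x ∈ B, ∀ y ∈ B, y ≠ x → ¬ R x y := by
  obtain ⟨M, hM⟩ := zorn_subset {B : Set X | B ⊆ A ∧ ∀ x ∈ B, ∀ y ∈ B, y ≠ x → ¬ R x y} (by
    intro C hC hch
    refine ⟨⋃₀ C, ⟨?_, ?_⟩, fun s hs => subset_sUnion_of_mem hs⟩
    · exact sUnion_subset fun s hs => (hC hs).1
    · rintro x ⟨s, hs, hx⟩ y ⟨t, ht, hy⟩ hne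
      rcases hch.total hs ht with h | h
      · exact (hC ht).2 x (h hx) y hy hne
      · exact (hC hs).2 x hx y (h hy) hne)
  refine ⟨M, hM.prop.1, ?_, hM.prop.2⟩
  intro hcount
  apply hA
  refine (hcount.union (hcount.biUnion fun x hx => hR x (hM.prop.1 hx))).mono ?_
  intro a ha
  by_contra hna
  simp only [mem_union, mem_iUnion, mem_setOf_eq, not_or, not_exists, not_and] at hna
  obtain ⟨h1, h2⟩ := hna
  apply h1
  refine hM.le_of_ge (y := insert a M) ⟨insert_subset ha hM.prop.1, ?_⟩
    (subset_insert a M) (mem_insert a M)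
  rintro x (rfl | hx) y (rfl | hy) hne
  · exact absurd rfl hne
  · exact fun h => h2 y hy ha (hs _ _ h)
  · exact h2 x hx ha
  · exact hM.prop.2 x hx y hy hne

theorem main_aux {X : Type*} [TopologicalSpace X] [SecondCountableTopology X]
    {n : ℕ} (c : X → X → Fin n) (hc : ∀ x y, c x y = c y x) (S : Finset (Fin n)) :
    ∀ A : Set X, ¬A.Countable → (∀ x ∈ A, ∀ y ∈ A, y ≠ x → c x y ∈ S) →
    ∃ B ⊆ A, ¬B.Countable ∧ ∃ i : Fin n, ∀ x ∈ B,
      StrongLimitPt {y | y ∈ B ∧ y ≠ x ∧ c x y = i} x := by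
  induction S using Finset.induction_on with
  | empty =>
    intro A hA h
    exfalso
    apply hA
    apply Set.Subsingleton.countable
    intro x hx y hy
    by_contra hne
    exact absurd (h y hy x hx hne) (Finset.notMem_empty _)
  | insert i S hi ih =>
    intro A hA h
    let G : Set X := {x | x ∈ A ∧ StrongLimitPt {y | y ∈ A ∧ y ≠ x ∧ c x y = i} x}
    by_cases hG : (A \ G).Countable
    · refine ⟨G, fun x hx => hx.1, ?_, i, ?_⟩
      · intro hGc
        apply hA
        refine (hG.union hGc).mono ?_
        intro x hx
        by_cases hxG : x ∈ G
        · exact Or.inr hxG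
        · exact Or.inl ⟨hx, hxG⟩
      · intro x hx U hU hcount
        apply hx.2 U hU
        refine (hcount.union hG).mono ?_
        rintro y ⟨hyU, hyA, hy⟩
        by_cases hyG : y ∈ G
        · exact Or.inl ⟨hyU, hyG, hy⟩
        · exact Or.inr ⟨hyA, hyG⟩
    · have : ∃ U : Set X,
          ¬ {x | x ∈ A ∧ x ∈ U ∧ (U ∩ {y | y ∈ A ∧ y ≠ x ∧ c x y = i}).Countable}.Countable := by
        by_contra hcon
        push Not at hcon
        apply hG
        refine ((TopologicalSpace.countable_countableBasis X).biUnion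
          (fun U _ => hcon U)).mono ?_
        rintro x ⟨hxA, hxG⟩
        have hx : ¬ StrongLimitPt {y | y ∈ A ∧ y ≠ x ∧ c x y = i} x := fun h => hxG ⟨hxA, h⟩
        unfold StrongLimitPt at hx
        push Not at hx
        obtain ⟨V, hV, hVc⟩ := hx
        obtain ⟨U, hU, hxU, hUV⟩ :=
          (TopologicalSpace.isBasis_countableBasis X).mem_nhds_iff.1 hV
        exact mem_biUnion hU ⟨hxA, hxU, hVc.mono (inter_subset_inter_left _ hUV)⟩
      obtain ⟨U, hU⟩ := this
      obtain ⟨B, hB, hBc, hBi⟩ := indep_aux _ hU (fun x y => y ≠ x ∧ c x y = i)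
        (fun x y h => ⟨h.1.symm, (hc y x).trans h.2⟩) (by
          intro x hx
          refine hx.2.2.mono ?_
          rintro y ⟨hy, hy2⟩
          exact ⟨hy.2.1, hy.1, hy2⟩)
      obtain ⟨D, hD, hD2⟩ := ih B hBc (by
        intro x hx y hy hne
        refine (Finset.mem_insert.1 (h x (hB hx).1 y (hB hy).1 hne)).resolve_left ?_
        exact fun he => hBi x hx y hy hne ⟨hne, he⟩)
      exact ⟨D, fun x hx => (hB (hD hx)).1, hD2⟩

/-- **Theorem (abstract cone lemma).** Let `X` be second countable, `A ⊆ X` uncountable,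
`n ≥ 1`, and `c` a symmetric coloring of the pairs from `X` by `n` colors.  Then there are an
uncountable `B ⊆ A` and a color `i` such that `B` is partially homogeneous for `i`: every
`x ∈ B` is a strong limit point of `{y ∈ B | y ≠ x ∧ c x y = i}`. -/
theorem partially_homogeneous (X : Type*) [TopologicalSpace X] [SecondCountableTopology X]
    (A : Set X) (hA : ¬A.Countable) (n : ℕ) (hn : 1 ≤ n)
    (c : X → X → Fin n) (hc : ∀ x y, c x y = c y x) :
    ∃ B ⊆ A, ¬B.Countable ∧ ∃ i : Fin n, ∀ x ∈ B,
      StrongLimitPt {y | y ∈ B ∧ y ≠ x ∧ c x y = i} x := by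
  exact main_aux c hc Finset.univ A hA (fun _ _ _ _ _ => Finset.mem_univ _)
end

section
/- Let P ⊆ ℝ^d be a compact convex d-polytope, let [x, y] be a segment that is maximal with respect to P and extreme, and let S ⊆ ℝ^d be an affine subspace containing x and y. Then dim(F_x ∩ S) + dim(F_y ∩ S) ≤ dim S − 1. -/
open Pointwise Filter Topology Set

open RealInnerProductSpace in
/-- A convex `d`-polytope in `ℝ^d`: a compact set with nonempty interior which is the
intersection of finitely many closed half-spaces. -/
def IsPolytope (d : ℕ) (P : Set (EuclideanSpace ℝ (Fin d))) : Prop :=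
  IsCompact P ∧ (interior P).Nonempty ∧
    ∃ (k : ℕ) (a : Fin k → EuclideanSpace ℝ (Fin d)) (b : Fin k → ℝ),
      (∀ i, a i ≠ 0) ∧ P = ⋂ i, {z | ⟪a i, z⟫ ≤ b i}

/-- A maximal segment `ℓ = [x, y]` is *extreme* if for every nonzero `t` and every `ε > 0`,
at least one of `ℓ + ε t` and `ℓ - ε t` is not contained in `P`. -/
def IsExtremeSeg {d : ℕ} (P : Set (EuclideanSpace ℝ (Fin d)))
    (x y : EuclideanSpace ℝ (Fin d)) : Prop :=
  IsMaxSeg P x y ∧ ∀ t : EuclideanSpace ℝ (Fin d), t ≠ 0 → ∀ ε : ℝ, 0 < ε →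
    ¬((ε • t +ᵥ segment ℝ x y ⊆ P) ∧ ((-(ε • t)) +ᵥ segment ℝ x y ⊆ P))

/-- The dimension of a set in `ℝ^d`: the dimension of its affine span. -/
noncomputable def setDim {d : ℕ} (s : Set (EuclideanSpace ℝ (Fin d))) : ℕ :=
  Module.finrank ℝ (affineSpan ℝ s).direction

open RealInnerProductSpace in
/-- A facet of the `d`-polytope `P`: a set of the form `P ∩ H` where `H` is a supporting
hyperplane of `P` and `P ∩ H` has affine dimension `d - 1`. -/
def IsFacet {d : ℕ} (P F : Set (EuclideanSpace ℝ (Fin d))) : Prop :=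
  ∃ (a : EuclideanSpace ℝ (Fin d)) (b : ℝ), a ≠ 0 ∧ (∃ w ∈ frontier P, ⟪a, w⟫ = b) ∧
    (∀ z ∈ P, ⟪a, z⟫ ≤ b) ∧ F = P ∩ {z | ⟪a, z⟫ = b} ∧ setDim F + 1 = d

/-- `F_x`: the intersection of all facets of `P` containing `x`. -/
def facetsInter {d : ℕ} (P : Set (EuclideanSpace ℝ (Fin d))) (x : EuclideanSpace ℝ (Fin d)) :
    Set (EuclideanSpace ℝ (Fin d)) :=
  ⋂₀ {F | IsFacet P F ∧ x ∈ F}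

section Helpers
open RealInnerProductSpace

lemma feas_aux {d k : ℕ} (J : Finset (Fin k)) (a : Fin k → EuclideanSpace ℝ (Fin d))
    (b : Fin k → ℝ) (p t : EuclideanSpace ℝ (Fin d))
    (h : ∀ i ∈ J, ⟪a i, p⟫ < b i ∨ (⟪a i, p⟫ ≤ b i ∧ ⟪a i, t⟫ = 0)) :
    ∀ᶠ ε in 𝓝 (0 : ℝ), ∀ i ∈ J, ⟪a i, p + ε • t⟫ ≤ b i := by
  rw [Filter.eventually_all_finset]
  intro i hi
  rcases h i hi with h | ⟨h, h0⟩
  · have hc : Continuous fun ε : ℝ => ⟪a i, p + ε • t⟫ := by fun_prop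
    have := hc.tendsto 0
    simp only [zero_smul, add_zero] at this
    filter_upwards [this.eventually_lt_const h] with ε hε using hε.le
  · refine Filter.Eventually.of_forall fun ε => ?_
    rw [inner_add_right, inner_smul_right, h0]
    simpa using h

lemma vectorSpan_orth {d : ℕ} (F : Set (EuclideanSpace ℝ (Fin d)))
    (a : EuclideanSpace ℝ (Fin d)) (b : ℝ) (h : ∀ z ∈ F, ⟪a, z⟫ = b) :
    vectorSpan ℝ F ≤ (ℝ ∙ a)ᗮ := by
  rw [vectorSpan_def, Submodule.span_le]
  rintro _ ⟨u, hu, v, hv, rfl⟩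
  simp only [SetLike.mem_coe, vsub_eq_sub, Submodule.mem_orthogonal_singleton_iff_inner_right]
  rw [inner_sub_right, h u hu, h v hv, sub_self]

lemma not_interior {d : ℕ} (P : Set (EuclideanSpace ℝ (Fin d)))
    (a : EuclideanSpace ℝ (Fin d)) (ha : a ≠ 0) (b : ℝ) (h : ∀ z ∈ P, ⟪a, z⟫ ≤ b)
    (p : EuclideanSpace ℝ (Fin d)) (hp : p ∈ interior P) : ⟪a, p⟫ < b := by
  have hc : Continuous fun ε : ℝ => p + ε • a := by fun_prop
  have h1 : ∀ᶠ ε in 𝓝 (0 : ℝ), p + ε • a ∈ P := by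
    apply hc.tendsto 0
    simpa using mem_interior_iff_mem_nhds.1 hp
  have h2 : ∀ᶠ ε in 𝓝[>] (0 : ℝ), p + ε • a ∈ P := h1.filter_mono nhdsWithin_le_nhds
  obtain ⟨ε, h3, h4⟩ := (h2.and self_mem_nhdsWithin).exists
  have h5 := h _ h3
  rw [inner_add_right, inner_smul_right] at h5
  have h6 : 0 < ⟪a, a⟫ := real_inner_self_pos.2 ha
  have h7 : 0 < ε * ⟪a, a⟫ := mul_pos h4 h6
  linarith

/-- A polytope is an intersection of finitely many facet-defining half-spaces. -/
lemma facet_rep {d : ℕ} (P : Set (EuclideanSpace ℝ (Fin d))) (hP : IsPolytope d P) :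
    ∃ (k : ℕ) (J : Finset (Fin k)) (a : Fin k → EuclideanSpace ℝ (Fin d)) (b : Fin k → ℝ),
      (∀ z, z ∈ P ↔ ∀ i ∈ J, ⟪a i, z⟫ ≤ b i) ∧
      ∀ j ∈ J, IsFacet P (P ∩ {z | ⟪a j, z⟫ = b j}) := by
  obtain ⟨-, ⟨c, hc⟩, k, a, b, ha, hPe⟩ := hP
  obtain ⟨J, hJ⟩ := exists_minimal_of_wellFoundedLT
    (fun J : Finset (Fin k) => ∀ z, z ∈ P ↔ ∀ i ∈ J, ⟪a i, z⟫ ≤ b i)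
    ⟨Finset.univ, fun z => by rw [hPe]; simp⟩
  refine ⟨k, J, a, b, hJ.prop, fun j hj => ?_⟩
  have hrep := hJ.prop
  have hle : ∀ i ∈ J, ∀ z ∈ P, ⟪a i, z⟫ ≤ b i := fun i hi z hz => (hrep z).1 hz i hi
  have hcs : ∀ i ∈ J, ⟪a i, c⟫ < b i := fun i hi =>
    not_interior P (a i) (ha i) (b i) (hle i hi) c hc
  have hne : ∃ w, (∀ i ∈ J.erase j, ⟪a i, w⟫ ≤ b i) ∧ b j < ⟪a j, w⟫ := by
    by_contra! hcon
    have hlt : J.erase j < J := Finset.erase_ssubset hj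
    refine hJ.not_prop_of_lt hlt fun z => ⟨fun hz i hi => hle i (Finset.mem_of_mem_erase hi) z hz,
      fun hz => (hrep z).2 fun i hi => ?_⟩
    by_cases hij : i = j
    · subst hij; exact hcon z hz
    · exact hz i (Finset.mem_erase.2 ⟨hij, hi⟩)
  obtain ⟨w, hw, hwj⟩ := hne
  have hcj := hcs j hj
  obtain ⟨l, hl0, hl1, hl⟩ : ∃ l : ℝ, 0 < l ∧ l < 1 ∧ (1 - l) * ⟪a j, c⟫ + l * ⟪a j, w⟫ = b j := by
    have hpos : 0 < ⟪a j, w⟫ - ⟪a j, c⟫ := by linarith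
    refine ⟨(b j - ⟪a j, c⟫) / (⟪a j, w⟫ - ⟪a j, c⟫), by apply div_pos <;> linarith, ?_, ?_⟩
    · rw [div_lt_one hpos]; linarith
    · field_simp; ring
  set p := (1 - l) • c + l • w with hp
  have hpi : ∀ i, ⟪a i, p⟫ = (1 - l) * ⟪a i, c⟫ + l * ⟪a i, w⟫ := fun i => by
    rw [hp, inner_add_right, inner_smul_right, inner_smul_right]
  have hpj : ⟪a j, p⟫ = b j := by rw [hpi, hl]
  have hpo : ∀ i ∈ J, i ≠ j → ⟪a i, p⟫ < b i := fun i hi hij => by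
    rw [hpi]
    have h1 := hcs i hi
    have h2 := hw i (Finset.mem_erase.2 ⟨hij, hi⟩)
    nlinarith
  have hfeas : ∀ t, ⟪a j, t⟫ = 0 → ∀ i ∈ J, ⟪a i, p⟫ < b i ∨ (⟪a i, p⟫ ≤ b i ∧ ⟪a i, t⟫ = 0) := by
    intro t ht i hi
    by_cases hij : i = j
    · subst hij; exact Or.inr ⟨hpj.le, ht⟩
    · exact Or.inl (hpo i hi hij)
  have hpP : p ∈ P := (hrep p).2 fun i hi => by
    rcases hfeas 0 (by simp) i hi with h | h
    · exact h.le
    · exact h.1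
  refine ⟨a j, b j, ha j, ⟨p, ⟨subset_closure hpP, fun hint => ?_⟩, hpj⟩, hle j hj, rfl, ?_⟩
  · exact (not_interior P (a j) (ha j) (b j) (hle j hj) p hint).ne hpj
  have hdir : vectorSpan ℝ (P ∩ {z | ⟪a j, z⟫ = b j}) = (ℝ ∙ a j)ᗮ := by
    apply le_antisymm (vectorSpan_orth _ _ (b j) fun z hz => hz.2)
    intro t ht
    rw [Submodule.mem_orthogonal_singleton_iff_inner_right] at ht
    have h2 := (feas_aux J a b p t (hfeas t ht)).filter_mono (nhdsWithin_le_nhds (s := Ioi 0))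
    obtain ⟨ε, h3, h4⟩ := (h2.and self_mem_nhdsWithin).exists
    have h4 : (0 : ℝ) < ε := h4
    have h5 : p + ε • t ∈ P ∩ {z | ⟪a j, z⟫ = b j} :=
      ⟨(hrep _).2 h3, by
        rw [mem_ofPred_eq, inner_add_right, inner_smul_right, ht, hpj]; simp⟩
    have h6 := vsub_mem_vectorSpan ℝ h5 (show p ∈ P ∩ {z | ⟪a j, z⟫ = b j} from ⟨hpP, hpj⟩)
    rw [vsub_eq_sub, add_sub_cancel_left] at h6
    exact (Submodule.smul_mem_iff _ h4.ne').1 h6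
  have h7 := (ℝ ∙ a j).finrank_add_finrank_orthogonal
  rw [finrank_span_singleton (ha j), finrank_euclideanSpace_fin] at h7
  rw [setDim, direction_affineSpan, hdir]
  omega

lemma local_move {d : ℕ} (P : Set (EuclideanSpace ℝ (Fin d))) (hP : IsPolytope d P)
    (x : EuclideanSpace ℝ (Fin d)) (hx : x ∈ P) (t : EuclideanSpace ℝ (Fin d))
    (S : Set (EuclideanSpace ℝ (Fin d)))
    (ht : t ∈ vectorSpan ℝ (facetsInter P x ∩ S)) :
    ∀ᶠ ε in 𝓝 (0 : ℝ), x + ε • t ∈ P := by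
  obtain ⟨k, J, a, b, hrep, hJ⟩ := facet_rep P hP
  have := feas_aux J a b x t (fun i hi => by
    rcases ((hrep x).1 hx i hi).lt_or_eq with h | h
    · exact Or.inl h
    · refine Or.inr ⟨h.le, ?_⟩
      rw [← Submodule.mem_orthogonal_singleton_iff_inner_right (𝕜 := ℝ)]
      exact vectorSpan_orth _ (a i) (b i) (fun z hz => (hz.1 _ ⟨hJ i hi, hx, h⟩).2) ht)
  filter_upwards [this] with ε hε using (hrep _).2 hε

end Helpers

/-- **Lemma.** Let `P ⊆ ℝ^d` be a compact convex `d`-polytope, let `[x, y]` be a maximal,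
extreme segment in `P`, and let `S` be an affine subspace containing `x` and `y`.  Then
`dim(F_x ∩ S) + dim(F_y ∩ S) ≤ dim S − 1`. -/
theorem facetsInter_dim_le (d : ℕ) (P : Set (EuclideanSpace ℝ (Fin d)))
    (hP : IsPolytope d P) (hPconv : Convex ℝ P)
    (x y : EuclideanSpace ℝ (Fin d)) (hseg : IsExtremeSeg P x y)
    (S : AffineSubspace ℝ (EuclideanSpace ℝ (Fin d))) (hx : x ∈ S) (hy : y ∈ S) :
    setDim (facetsInter P x ∩ S) + setDim (facetsInter P y ∩ S) + 1 ≤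
      Module.finrank ℝ S.direction := by
  obtain ⟨⟨hsub, hmax⟩, hext⟩ := hseg
  have hxP : x ∈ P := hsub (left_mem_segment ℝ x y)
  have hyP : y ∈ P := hsub (right_mem_segment ℝ x y)
  have hseg : ∀ u ∈ P, ∀ v ∈ P, segment ℝ u v ⊆ P := fun u hu v hv => hPconv.segment_subset hu hv
  have htr : ∀ t : EuclideanSpace ℝ (Fin d), x + t ∈ P → y + t ∈ P → t +ᵥ segment ℝ x y ⊆ P := by
    rintro t h1 h2 _ ⟨_, ⟨α, β, hα, hβ, hab, rfl⟩, rfl⟩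
    have := hPconv h1 h2 hα hβ hab
    convert this using 1
    have hα' : α = 1 - β := by linarith
    subst hα'
    simp only [vadd_eq_add]
    module
  set Vx := vectorSpan ℝ (facetsInter P x ∩ S) with hVx
  set Vy := vectorSpan ℝ (facetsInter P y ∩ S) with hVy
  have hmx := local_move P hP x hxP
  have hmy := local_move P hP y hyP
  have hdisj : Vx ⊓ Vy = ⊥ := by
    rw [eq_bot_iff]
    rintro t ⟨h1, h2⟩
    by_contra ht
    have ev := (((hmx t S h1).and (hmx (-t) S (neg_mem h1))).and
      ((hmy t S h2).and (hmy (-t) S (neg_mem h2)))).filter_mono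
        (nhdsWithin_le_nhds (s := Ioi 0))
    obtain ⟨ε, ⟨⟨e1, e2⟩, e3, e4⟩, e5⟩ := (ev.and self_mem_nhdsWithin).exists
    rw [smul_neg] at e2 e4
    exact hext t (by simpa using ht) ε e5 ⟨htr _ e1 e3, htr _ e2 e4⟩
  have hnot : y - x ∉ Vx ⊔ Vy := by
    intro h
    obtain ⟨p, hp, q, hq, hpq⟩ := Submodule.mem_sup.1 h
    have ev := ((hmx (-p) S (neg_mem hp)).and (hmy q S hq)).filter_mono
        (nhdsWithin_le_nhds (s := Ioi 0))
    obtain ⟨ε, ⟨e1, e2⟩, e5⟩ := (ev.and self_mem_nhdsWithin).exists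
    have e5 : (0 : ℝ) < ε := e5
    refine hmax ⟨x + ε • (-p) - (1 + ε) • x, 1 + ε, by linarith, ?_⟩
    rintro _ ⟨_, ⟨_, ⟨α, β, hα, hβ, hab, rfl⟩, rfl⟩, rfl⟩
    have := hPconv e1 e2 hα hβ hab
    convert this using 1
    have hq' : q = y - x - p := by rw [← hpq]; abel
    have hα' : α = 1 - β := by linarith
    subst hq' hα'
    simp only [vadd_eq_add]
    module
  have hle : ∀ F : Set (EuclideanSpace ℝ (Fin d)), vectorSpan ℝ (F ∩ S) ≤ S.direction := by
    intro F
    rw [← direction_affineSpan]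
    exact AffineSubspace.direction_le (affineSpan_le.2 inter_subset_right)
  have hyx : y - x ∈ S.direction := AffineSubspace.vsub_mem_direction hy hx
  have hlt : Vx ⊔ Vy < S.direction :=
    lt_of_le_of_ne (sup_le (hle _) (hle _)) fun h => hnot (h ▸ hyx)
  have h1 := Submodule.finrank_lt_finrank_of_lt hlt
  have h2 := Submodule.finrank_sup_add_finrank_inf_eq Vx Vy
  rw [hdisj, finrank_bot] at h2
  rw [setDim, setDim, direction_affineSpan, direction_affineSpan]
  change Module.finrank ℝ Vx + Module.finrank ℝ Vy + 1 ≤ _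
  omega
end

section
/- Let P ⊆ ℝ^d be a compact convex d-polytope and let [x, y] be a segment maximal with respect to P. Suppose u_n → x and v_n → y with u_n ≠ v_n for all n. Then there exist segments [u'_n, v'_n] maximal with respect to P such that v'_n − u'_n is a positive scalar multiple of v_n − u_n for each n, and a subsequence (n_k) with u'_{n_k} → x and v'_{n_k} → y. -/
open Pointwise Filter Topology Set

theorem maxSeg_aux_shift {d : ℕ} {P : Set (EuclideanSpace ℝ (Fin d))} (hP : IsPolytope d P)
    (p : ℕ → EuclideanSpace ℝ (Fin d)) (hp : ∀ n, p n ∈ P) (p0 x : EuclideanSpace ℝ (Fin d))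
    (hp0 : p0 ∈ P) (hx : x ∈ P) (hlim : Tendsto p atTop (𝓝 p0)) :
    ∀ᶠ n in atTop, p n + (1/2 : ℝ) • (x - p0) ∈ P := by
  obtain ⟨-, -, k, a, b, -, rfl⟩ := hP
  simp only [mem_iInter, mem_ofPred_eq] at *
  rw [eventually_all]
  intro i
  have h1 := hp0 i
  have h2 := hx i
  simp only [inner_add_right, inner_smul_right, inner_sub_right]
  by_cases h : inner ℝ (a i) x = b i ∧ inner ℝ (a i) p0 = b i
  · refine Eventually.of_forall fun n => ?_
    have := hp n i
    rw [h.1, h.2]; linarith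
  · have hlt : inner ℝ (a i) p0 + 1/2 * (inner ℝ (a i) x - inner ℝ (a i) p0) < b i := by
      by_contra hc
      push Not at hc
      exact h ⟨by linarith, by linarith⟩
    have ht : Tendsto (fun n => inner ℝ (a i) (p n)
        + 1/2 * (inner ℝ (a i) x - inner ℝ (a i) p0)) atTop
        (𝓝 (inner ℝ (a i) p0 + 1/2 * (inner ℝ (a i) x - inner ℝ (a i) p0))) :=
      (tendsto_const_nhds.inner hlim).add_const _
    exact (ht.eventually_lt_const hlt).mono fun n hn => hn.le

theorem maxSeg_aux_exists {d : ℕ} {P : Set (EuclideanSpace ℝ (Fin d))} (hc : IsCompact P)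
    (hi : (interior P).Nonempty) (w x : EuclideanSpace ℝ (Fin d)) (hw : w ≠ 0) :
    ∃ (T : ℝ) (p : EuclideanSpace ℝ (Fin d)), 0 < T ∧ p ∈ P ∧ p + T • w ∈ P ∧
      (∀ p' t, p' ∈ P → p' + t • w ∈ P → t ≤ T) ∧
      (∀ p', p' ∈ P → p' + T • w ∈ P → ‖p - x‖ ≤ ‖p' - x‖) := by
  have hw2 : (0:ℝ) < ‖w‖ ^ 2 := by positivity
  obtain ⟨c, hci⟩ := hi
  have hcP := interior_subset hci
  -- positive
  have hpos : ∃ t : ℝ, 0 < t ∧ c + t • w ∈ P := by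
    have ht : Tendsto (fun t : ℝ => c + t • w) (𝓝[>] 0) (𝓝 c) := by
      have : Continuous (fun t : ℝ => c + t • w) := by fun_prop
      have h := (this.tendsto 0).mono_left (nhdsWithin_le_nhds (s := Ioi 0))
      simpa using h
    have h1 := ht.eventually (mem_interior_iff_mem_nhds.1 hci)
    obtain ⟨t, h, h'⟩ := (h1.and self_mem_nhdsWithin).exists
    exact ⟨t, h', h⟩
  have hf : ∀ (p : EuclideanSpace ℝ (Fin d)) (t : ℝ),
      inner ℝ w (p + t • w - p) / ‖w‖ ^ 2 = t := by
    intro p t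
    rw [add_sub_cancel_left, inner_smul_right, real_inner_self_eq_norm_sq]
    field_simp
  let S : Set (EuclideanSpace ℝ (Fin d) × EuclideanSpace ℝ (Fin d)) :=
    (P ×ˢ P) ∩ {z | z.2 = z.1 + (inner ℝ w (z.2 - z.1) / ‖w‖ ^ 2) • w}
  have hS : IsCompact S := by
    refine (hc.prod hc).inter_right (isClosed_eq (by fun_prop) (by fun_prop))
  have hmem : ∀ (p : EuclideanSpace ℝ (Fin d)) (t : ℝ), p ∈ P → p + t • w ∈ P → (p, p + t • w) ∈ S := by
    intro p t h1 h2
    refine ⟨⟨h1, h2⟩, ?_⟩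
    simp only [mem_ofPred_eq, hf]
  obtain ⟨⟨p, q⟩, hpq, hmaxi⟩ := hS.exists_isMaxOn ⟨_, hmem c 0 hcP (by simpa using hcP)⟩
    (f := fun z => inner ℝ w (z.2 - z.1) / ‖w‖ ^ 2) (by fun_prop)
  set T := inner ℝ w (q - p) / ‖w‖ ^ 2 with hT
  have hle : ∀ p' t, p' ∈ P → p' + t • w ∈ P → t ≤ T := by
    intro p' t h1 h2
    have := hmaxi (hmem p' t h1 h2)
    simp only [mem_ofPred_eq, hf] at this
    exact this
  have hq : q = p + T • w := hpq.2
  have hO : IsCompact (P ∩ (fun z => z + T • w) ⁻¹' P) :=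
    hc.inter_right (hc.isClosed.preimage (by fun_prop))
  obtain ⟨r, hr, hmin⟩ := hO.exists_isMinOn ⟨p, hpq.1.1, by
    have := hpq.1.2
    rw [hq] at this; exact this⟩ (f := fun z => ‖z - x‖) (by fun_prop)
  obtain ⟨t, ht, htP⟩ := hpos
  exact ⟨T, r, ht.trans_le (hle c t hcP htP), hr.1, hr.2, hle, fun p' h1 h2 => hmin ⟨h1, h2⟩⟩

theorem maxSeg_aux_isMax {d : ℕ} {P : Set (EuclideanSpace ℝ (Fin d))} (hconv : Convex ℝ P)
    (w p : EuclideanSpace ℝ (Fin d)) (T : ℝ) (hT : 0 < T) (hp : p ∈ P) (hq : p + T • w ∈ P)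
    (hle : ∀ p' t, p' ∈ P → p' + t • w ∈ P → t ≤ T) : IsMaxSeg P p (p + T • w) := by
  refine ⟨hconv.segment_subset hp hq, ?_⟩
  rintro ⟨z, s, hs, h⟩
  have h1 : z + s • p ∈ P :=
    h (vadd_mem_vadd_set (smul_mem_smul_set (left_mem_segment ℝ _ _)))
  have h2 : z + s • (p + T • w) ∈ P :=
    h (vadd_mem_vadd_set (smul_mem_smul_set (right_mem_segment ℝ _ _)))
  have := hle (z + s • p) (s * T) h1 (by
    convert h2 using 1
    module)
  nlinarith

theorem maxSeg_aux_le {d : ℕ} {P : Set (EuclideanSpace ℝ (Fin d))} (hconv : Convex ℝ P)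
    (x y : EuclideanSpace ℝ (Fin d)) (hmax : IsMaxSeg P x y) (p : EuclideanSpace ℝ (Fin d))
    (t : ℝ) (hp : p ∈ P) (hq : p + t • (y - x) ∈ P) : t ≤ 1 := by
  by_contra! ht
  refine hmax.2 ⟨p - t • x, t, ht, ?_⟩
  rintro _ ⟨_, ⟨_, ⟨α, β, hα, hβ, hab, rfl⟩, rfl⟩, rfl⟩
  have := hconv hp hq hα hβ hab
  convert this using 1
  obtain rfl : α = 1 - β := by linarith
  simp only [vadd_eq_add]
  module

theorem maxSeg_translation (d : ℕ) (P : Set (EuclideanSpace ℝ (Fin d)))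
    (hP : IsPolytope d P) (hPconv : Convex ℝ P)
    (x y : EuclideanSpace ℝ (Fin d)) (hmax : IsMaxSeg P x y)
    (u v : ℕ → EuclideanSpace ℝ (Fin d)) (hne : ∀ n, u n ≠ v n)
    (hu : Tendsto u atTop (𝓝 x)) (hv : Tendsto v atTop (𝓝 y)) :
    ∃ u' v' : ℕ → EuclideanSpace ℝ (Fin d),
      (∀ n, IsMaxSeg P (u' n) (v' n) ∧ ∃ c : ℝ, 0 < c ∧ v' n - u' n = c • (v n - u n)) ∧
      ∃ φ : ℕ → ℕ, StrictMono φ ∧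
        Tendsto (u' ∘ φ) atTop (𝓝 x) ∧ Tendsto (v' ∘ φ) atTop (𝓝 y) := by
  have hc := hP.1
  have hi := hP.2.1
  have hxP : x ∈ P := hmax.1 (left_mem_segment ℝ _ _)
  have hyP : y ∈ P := hmax.1 (right_mem_segment ℝ _ _)
  have hw0 : y - x ≠ 0 := by
    intro h
    have := maxSeg_aux_le hPconv x y hmax x 2 hxP (by simpa [h] using hxP)
    norm_num at this
  have hwn : ∀ n, v n - u n ≠ 0 := fun n => sub_ne_zero.2 (hne n).symm
  have hwlim : Tendsto (fun n => v n - u n) atTop (𝓝 (y - x)) := hv.sub hu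
  choose T p hT hp hq hle hmin using
    fun n => maxSeg_aux_exists hc hi (v n - u n) x (hwn n)
  refine ⟨p, fun n => p n + T n • (v n - u n), fun n =>
    ⟨maxSeg_aux_isMax hPconv _ _ _ (hT n) (hp n) (hq n) (hle n), T n, hT n, by simp⟩, ?_⟩
  obtain ⟨⟨p0, q0⟩, hpq0, φ, hφ, hlim⟩ := (hc.prod hc).tendsto_subseq
    (x := fun n => (p n, p n + T n • (v n - u n))) (fun n => ⟨hp n, hq n⟩)
  have hpl : Tendsto (fun n => p (φ n)) atTop (𝓝 p0) := (continuous_fst.tendsto _).comp hlim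
  have hql : Tendsto (fun n => p (φ n) + T (φ n) • (v (φ n) - u (φ n))) atTop (𝓝 q0) :=
    (continuous_snd.tendsto _).comp hlim
  have hwl : Tendsto (fun n => v (φ n) - u (φ n)) atTop (𝓝 (y - x)) :=
    hwlim.comp hφ.tendsto_atTop
  obtain ⟨hp0, hq0⟩ : p0 ∈ P ∧ q0 ∈ P := hpq0
  obtain ⟨t, hTl⟩ : ∃ t, Tendsto (fun n => T (φ n)) atTop (𝓝 t) := by
    refine ⟨inner ℝ (y - x) (q0 - p0) / ‖y - x‖ ^ 2, ?_⟩
    have h := (hwl.inner (hql.sub hpl)).div (hwl.norm.pow 2) (by simpa using hw0)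
    refine h.congr fun n => ?_
    have : ‖v (φ n) - u (φ n)‖ ≠ 0 := norm_ne_zero_iff.2 (hwn _)
    simp only [Pi.div_apply]
    rw [add_sub_cancel_left, inner_smul_right, real_inner_self_eq_norm_sq]
    field_simp
  have hq0e : q0 = p0 + t • (y - x) := tendsto_nhds_unique hql (hpl.add (hTl.smul hwl))
  have ht1 : t ≤ 1 := maxSeg_aux_le hPconv x y hmax p0 t hp0 (hq0e ▸ hq0)
  have ht2 : 1 ≤ t := by
    obtain ⟨c, hci⟩ := hi
    refine le_of_forall_lt fun s hs => ?_
    obtain ⟨θ, h1, h2⟩ := exists_between (max_lt hs zero_lt_one)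
    have hθ0 : 0 < θ := (le_max_right _ _).trans_lt h1
    have hθs : s < θ := (le_max_left _ _).trans_lt h1
    refine hθs.trans_le (ge_of_tendsto hTl ?_)
    have hA : (1 - θ) • c + θ • x ∈ P :=
      hPconv (interior_subset hci) hxP (by linarith) hθ0.le (by ring)
    have hB : (1 - θ) • c + θ • y ∈ interior P :=
      hPconv.combo_interior_self_mem_interior hci hyP (by linarith) hθ0.le (by ring)
    have hl : Tendsto (fun n => ((1 - θ) • c + θ • x) + θ • (v (φ n) - u (φ n))) atTop
        (𝓝 ((1 - θ) • c + θ • y)) := by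
      have : (1 - θ) • c + θ • y = ((1 - θ) • c + θ • x) + θ • (y - x) := by module
      rw [this]
      exact tendsto_const_nhds.add (hwl.const_smul θ)
    exact (hl.eventually (mem_interior_iff_mem_nhds.1 hB)).mono
      fun n hn => hle (φ n) _ θ hA hn
  obtain rfl : t = 1 := le_antisymm ht1 ht2
  have hxp : p0 = x := by
    have e1 := maxSeg_aux_shift hP _ (fun n => hp (φ n)) p0 x hp0 hxP hpl
    have e2 := maxSeg_aux_shift hP _ (fun n => hq (φ n)) q0 y hq0 hyP hql
    have hl : Tendsto (fun n => p (φ n) + (1/2 : ℝ) • (x - p0) - x) atTop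
        (𝓝 (p0 + (1/2 : ℝ) • (x - p0) - x)) := (hpl.add_const _).sub_const _
    have hlt := le_of_tendsto_of_tendsto (hpl.sub_const x).norm hl.norm (by
      filter_upwards [e1, e2] with n h1 h2
      refine hmin (φ n) _ h1 ?_
      convert h2 using 1
      rw [hq0e]
      module)
    have : p0 + (1/2 : ℝ) • (x - p0) - x = (1/2 : ℝ) • (p0 - x) := by module
    rw [this, norm_smul] at hlt
    norm_num at hlt
    have h0 : ‖p0 - x‖ = 0 := le_antisymm (by linarith) (norm_nonneg _)
    exact sub_eq_zero.1 (norm_eq_zero.1 h0)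
  subst hxp
  refine ⟨φ, hφ, hpl, ?_⟩
  have : q0 = y := by rw [hq0e]; module
  rw [← this]
  exact hql
end

section
/- Let P ⊆ ℝ^d be a compact convex d-polytope and let [x, y] be a segment that is maximal with respect to P and extreme. Let U' and V' be neighborhoods of x and y respectively. Then there are neighborhoods U ⊆ U' of x and V ⊆ V' of y such that whenever u ∈ U, v ∈ V and [u, v] is maximal with respect to P, there exists t ∈ ℝ^d such that the translate [u + t, v + t] is contained in P, is extreme and maximal with respect to P, and satisfies u + t ∈ U' and v + t ∈ V'. -/
open Pointwise Filter Topology Set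

theorem seg_vadd_aux {d : ℕ} (t x y : EuclideanSpace ℝ (Fin d)) :
    segment ℝ (x + t) (y + t) = t +ᵥ segment ℝ x y := by
  have := segment_translate_image ℝ t x y
  rw [add_comm x t, add_comm y t, ← this]
  rfl

theorem isMaxSeg_translate_aux {d : ℕ} {P : Set (EuclideanSpace ℝ (Fin d))}
    {u v t : EuclideanSpace ℝ (Fin d)} (h : IsMaxSeg P u v)
    (h1 : segment ℝ (u + t) (v + t) ⊆ P) : IsMaxSeg P (u + t) (v + t) := by
  refine ⟨h1, ?_⟩
  rintro ⟨z, s, hs, hz⟩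
  refine h.2 ⟨z + s • t, s, hs, ?_⟩
  rw [seg_vadd_aux] at hz
  rintro _ ⟨_, ⟨q, hq, rfl⟩, rfl⟩
  apply hz
  refine ⟨s • (t + q), ⟨t + q, ⟨q, hq, rfl⟩, rfl⟩, ?_⟩
  simp [smul_add, add_assoc]

open RealInnerProductSpace

/-- **Lemma.** Let `P ⊆ ℝ^d` be a compact convex `d`-polytope and `[x, y]` a maximal extreme
segment.  Given neighborhoods `U'` of `x` and `V'` of `y`, there are smaller neighborhoods
`U ⊆ U'` of `x` and `V ⊆ V'` of `y` such that whenever `u ∈ U`, `v ∈ V` and `[u, v]` is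
maximal with respect to `P`, some translate `[u + t, v + t]` lies in `P`, is extreme and
maximal with respect to `P`, and has `u + t ∈ U'` and `v + t ∈ V'`. -/
theorem extremeSeg_translation (d : ℕ) (P : Set (EuclideanSpace ℝ (Fin d)))
    (hP : IsPolytope d P) (hPconv : Convex ℝ P)
    (x y : EuclideanSpace ℝ (Fin d)) (hseg : IsExtremeSeg P x y)
    (U' V' : Set (EuclideanSpace ℝ (Fin d))) (hU' : U' ∈ 𝓝 x) (hV' : V' ∈ 𝓝 y) :
    ∃ U ∈ 𝓝 x, ∃ V ∈ 𝓝 y, U ⊆ U' ∧ V ⊆ V' ∧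
      ∀ u ∈ U, ∀ v ∈ V, IsMaxSeg P u v →
        ∃ t : EuclideanSpace ℝ (Fin d),
          IsExtremeSeg P (u + t) (v + t) ∧ u + t ∈ U' ∧ v + t ∈ V' := by
  classical
  obtain ⟨hcomp, -, k, a, b, -, hPab⟩ := hP
  have memP : ∀ z, z ∈ P ↔ ∀ i, ⟪a i, z⟫ ≤ b i := by
    intro z; rw [hPab]; simp
  let c : Fin k → EuclideanSpace ℝ (Fin d) → ℝ := fun i w => min (b i) (b i - ⟪a i, w⟫)
  have hc : ∀ i, Continuous (c i) := by intro i; fun_prop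
  have memQ : ∀ w p, (p ∈ P ∧ p + w ∈ P) ↔ ∀ i, ⟪a i, p⟫ ≤ c i w := by
    intro w p
    rw [memP, memP, ← forall_and]
    refine forall_congr' fun i => ?_
    simp only [c, le_min_iff, inner_add_right]
    constructor <;> rintro ⟨h1, h2⟩ <;> constructor <;> linarith
  have hxP : x ∈ P := hseg.1.1 (left_mem_segment ℝ x y)
  have hyP : y ∈ P := hseg.1.1 (right_mem_segment ℝ x y)
  have hxQ : ∀ i, ⟪a i, x⟫ ≤ c i (y - x) := (memQ _ _).1 ⟨hxP, by simpa using hyP⟩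
  let J : Finset (Fin k) := Finset.univ.filter fun i => ⟪a i, x⟫ = c i (y - x)
  let L : EuclideanSpace ℝ (Fin d) →ₗ[ℝ] (Fin k → ℝ) :=
    LinearMap.pi fun i => if i ∈ J then (innerSL ℝ (a i)).toLinearMap else 0
  have hL : ∀ z i, L z i = if i ∈ J then ⟪a i, z⟫ else 0 := by
    intro z i
    by_cases h : i ∈ J <;> simp [L, h]
  -- injectivity
  have hker : LinearMap.ker L = ⊥ := by
    rw [LinearMap.ker_eq_bot']
    intro t ht
    by_contra ht0
    have hJ0 : ∀ i ∈ J, ⟪a i, t⟫ = 0 := by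
      intro i hi
      have := hL t i
      rw [ht] at this
      simpa [hi] using this.symm
    have hev : ∀ᶠ e : ℝ in 𝓝 0, ∀ i, ⟪a i, x + e • t⟫ ≤ c i (y - x) := by
      rw [eventually_all]
      intro i
      by_cases hi : i ∈ J
      · refine Eventually.of_forall fun e => ?_
        rw [inner_add_right, inner_smul_right, hJ0 i hi]
        simpa using hxQ i
      · have hlt : ⟪a i, x⟫ < c i (y - x) :=
          lt_of_le_of_ne (hxQ i) (fun h => hi (by simp [J, h]))
        have hcont : Continuous fun e : ℝ => ⟪a i, x + e • t⟫ := by fun_prop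
        have := hcont.tendsto 0
        simp only [zero_smul, add_zero] at this
        exact (this.eventually (gt_mem_nhds hlt)).mono fun e he => le_of_lt he
    obtain ⟨e, he, hball⟩ := Metric.eventually_nhds_iff.1 hev
    have key : ∀ r : ℝ, |r| < e → (r • t) +ᵥ segment ℝ x y ⊆ P := by
      intro r hr
      have := (memQ _ _).2 (hball (y := r) (by simpa using hr))
      rw [← seg_vadd_aux]
      refine hPconv.segment_subset this.1 ?_
      have h2 := this.2
      have e2 : x + r • t + (y - x) = y + r • t := by abel
      rwa [e2] at h2
    refine hseg.2 t ht0 (e / 2) (by positivity) ⟨key _ ?_, ?_⟩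
    · rw [abs_of_pos (by positivity)]; linarith
    · rw [← neg_smul]
      apply key
      rw [abs_neg, abs_of_pos (by positivity)]; linarith
  obtain ⟨K, -, hK⟩ := L.exists_antilipschitzWith hker
  let R : EuclideanSpace ℝ (Fin d) × EuclideanSpace ℝ (Fin d) → ℝ := fun q =>
    ∑ i ∈ J, (c i (q.2 - q.1) - ⟪a i, q.1⟫) + ∑ i ∈ J, |c i (q.2 - q.1) - c i (y - x)|
  have hR : Continuous R := by
    have : ∀ i, Continuous fun q : EuclideanSpace ℝ (Fin d) × EuclideanSpace ℝ (Fin d) =>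
      c i (q.2 - q.1) := fun i => (hc i).comp (by fun_prop)
    fun_prop
  have hR0 : R (x, y) = 0 := by
    have : ∑ i ∈ J, (c i (y - x) - ⟪a i, x⟫) = 0 := by
      refine Finset.sum_eq_zero fun i hi => ?_
      have : ⟪a i, x⟫ = c i (y - x) := by simpa [J] using hi
      rw [this, sub_self]
    simp only [R, this, sub_self, abs_zero, Finset.sum_const_zero, add_zero]
  obtain ⟨δ₁, hδ₁, hb₁⟩ := Metric.mem_nhds_iff.1 hU'
  obtain ⟨δ₂, hδ₂, hb₂⟩ := Metric.mem_nhds_iff.1 hV'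
  obtain ⟨δ, hδ, hδ1, hδ2⟩ : ∃ δ : ℝ, 0 < δ ∧ δ ≤ δ₁ ∧ δ ≤ δ₂ :=
    ⟨min δ₁ δ₂, lt_min hδ₁ hδ₂, min_le_left _ _, min_le_right _ _⟩
  have ev1 : ∀ᶠ q in 𝓝 (x, y), (K : ℝ) * R q < δ / 2 := by
    have h : Continuous fun q => (K : ℝ) * R q := by fun_prop
    have := h.tendsto (x, y)
    simp only [hR0, mul_zero] at this
    exact this.eventually (gt_mem_nhds (by positivity))
  have ev2 : ∀ᶠ q in 𝓝 (x, y), ‖(q.2 - q.1) - (y - x)‖ < δ / 2 := by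
    have h : Continuous fun q : EuclideanSpace ℝ (Fin d) × EuclideanSpace ℝ (Fin d) =>
      ‖(q.2 - q.1) - (y - x)‖ := by fun_prop
    have := h.tendsto (x, y)
    simp only [sub_self, norm_zero] at this
    exact this.eventually (gt_mem_nhds (by positivity))
  have ev := ev1.and ev2
  rw [nhds_prod_eq] at ev
  obtain ⟨A, hA, B, hB, hAB⟩ := Filter.mem_prod_iff.1 ev
  refine ⟨A ∩ U', inter_mem hA hU', B ∩ V', inter_mem hB hV', inter_subset_right,
    inter_subset_right, ?_⟩
  rintro u ⟨huA, -⟩ v ⟨hvB, -⟩ huv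
  obtain ⟨h1, h2⟩ := hAB (Set.mk_mem_prod huA hvB)
  simp only at h2
  let w := v - u
  let Q : Set (EuclideanSpace ℝ (Fin d)) := {p | p ∈ P ∧ p + w ∈ P}
  have hQc : IsCompact Q :=
    hcomp.inter_right (hcomp.isClosed.preimage (by fun_prop : Continuous fun p => p + w))
  have huQ : u ∈ Q := ⟨huv.1 (left_mem_segment ℝ u v), by
    simpa [w] using huv.1 (right_mem_segment ℝ u v)⟩
  let f : EuclideanSpace ℝ (Fin d) →L[ℝ] ℝ := innerSL ℝ (∑ i ∈ J, a i)
  have hf : ∀ z, f z = ∑ i ∈ J, ⟪a i, z⟫ := by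
    intro z; simp [f, sum_inner]
  have hexp : IsExposed ℝ Q (f.toExposed Q) := ContinuousLinearMap.toExposed.isExposed
  have hFne : (f.toExposed Q).Nonempty := by
    obtain ⟨m, hm, hmax⟩ := hQc.exists_isMaxOn ⟨u, huQ⟩ f.continuous.continuousOn
    exact ⟨m, hm, fun z hz => hmax hz⟩
  obtain ⟨p, hp⟩ := (hexp.isCompact hQc).extremePoints_nonempty hFne
  have hpF := hp.1
  have hpE : p ∈ Q.extremePoints ℝ := hexp.isExtreme.extremePoints_subset_extremePoints hp
  have hpQ : p ∈ Q := hpF.1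
  have hfp : f u ≤ f p := hpF.2 u huQ
  have hpc : ∀ i, ⟪a i, p⟫ ≤ c i w := (memQ _ _).1 hpQ
  have hRnn : 0 ≤ R (u, v) := by
    refine add_nonneg (Finset.sum_nonneg fun i _ => ?_) (Finset.sum_nonneg fun i _ => abs_nonneg _)
    exact sub_nonneg.2 ((memQ _ _).1 huQ i)
  have hdist : ‖p - x‖ ≤ K * R (u, v) := by
    have h3 := hK.le_mul_dist p x
    rw [dist_eq_norm, dist_eq_norm, ← map_sub] at h3
    refine h3.trans (mul_le_mul_of_nonneg_left ?_ K.2)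
    rw [pi_norm_le_iff_of_nonneg hRnn]
    intro i
    rw [hL]
    split_ifs with hi
    · have hxi : ⟪a i, x⟫ = c i (y - x) := by simpa [J] using hi
      have e1 : c i w - ⟪a i, p⟫ ≤ ∑ i ∈ J, (c i w - ⟪a i, u⟫) := by
        have e3 : c i w - ⟪a i, p⟫ ≤ ∑ i ∈ J, (c i w - ⟪a i, p⟫) :=
          Finset.single_le_sum (f := fun i => c i w - ⟪a i, p⟫)
            (fun j _ => sub_nonneg.2 (hpc j)) hi
        rw [hf, hf] at hfp
        rw [Finset.sum_sub_distrib] at e3 ⊢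
        linarith
      have e2 : |c i w - c i (y - x)| ≤ ∑ i ∈ J, |c i w - c i (y - x)| :=
        Finset.single_le_sum (f := fun i => |c i w - c i (y - x)|)
            (fun j _ => abs_nonneg _) hi
      have e4 := abs_le.1 e2
      have e5 := hpc i
      have e6 : R (u, v) = ∑ i ∈ J, (c i w - ⟪a i, u⟫) + ∑ i ∈ J, |c i w - c i (y - x)| := rfl
      have e7 : 0 ≤ c i w - ⟪a i, p⟫ := sub_nonneg.2 e5
      rw [Real.norm_eq_abs, inner_sub_right, hxi, e6, abs_le]
      constructor <;> linarith [e4.1, e4.2]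
    · simpa using hRnn
  have hut : u + (p - u) = p := by abel
  have hvt : v + (p - u) = p + w := by simp only [w]; abel
  have hsub : segment ℝ (u + (p - u)) (v + (p - u)) ⊆ P := by
    rw [hut, hvt]; exact hPconv.segment_subset hpQ.1 hpQ.2
  refine ⟨p - u, ⟨isMaxSeg_translate_aux huv hsub, ?_⟩, ?_, ?_⟩
  · intro t ht e he
    rw [hut, hvt, ← seg_vadd_aux, ← seg_vadd_aux]
    rintro ⟨g1, g2⟩
    have q1 : p + e • t ∈ Q := ⟨g1 (left_mem_segment ℝ _ _), by
      rw [add_right_comm]; exact g1 (right_mem_segment ℝ _ _)⟩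
    have q2 : p + -(e • t) ∈ Q := ⟨g2 (left_mem_segment ℝ _ _), by
      rw [add_right_comm]; exact g2 (right_mem_segment ℝ _ _)⟩
    have hmid : p ∈ openSegment ℝ (p + e • t) (p + -(e • t)) :=
      ⟨1/2, 1/2, by norm_num, by norm_num, by norm_num, by module⟩
    have h5 := hpE.2 q1 q2 hmid
    have h6 : e • t = 0 := by simpa using h5
    rcases smul_eq_zero.1 h6 with h | h
    · exact he.ne' h
    · exact ht h
  · rw [hut]
    apply hb₁
    rw [mem_ball_iff_norm]
    linarith
  · rw [hvt]
    apply hb₂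
    rw [mem_ball_iff_norm]
    have e8 : p + w - y = (p - x) + ((v - u) - (y - x)) := by simp only [w]; abel
    rw [e8]
    have := norm_add_le (p - x) ((v - u) - (y - x))
    linarith
end

section
/- Let P ⊆ ℝ² be compact and convex with nonempty interior. Then there exist δ > 0 and a finite set F ⊆ ∂P such that: (i) for every x ∈ ∂P \ F, every segment ℓ maximal with respect to P with endpoint x, and every supporting line H of P at x, |u_ℓ · n_H| > δ; and (ii) for every x ∈ F and every ε > 0 there exist a segment ℓ maximal with respect to P with endpoint x and a supporting line H of P at x with |u_ℓ · n_H| < ε (i.e., δ_P(x) = 0 for x ∈ F). -/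
open Pointwise Filter Topology Set RealInnerProductSpace

abbrev E2 := EuclideanSpace ℝ (Fin 2)

def QP (P : Set E2) (t : E2 × E2 × E2 × E2) : Prop :=
  t.1 ∈ P ∧ t.2.1 ∈ P ∧ ‖t.2.2.1‖ = 1 ∧ ‖t.2.2.2‖ = 1 ∧
    ∀ p ∈ P, ⟪t.2.2.1, p⟫ ≤ ⟪t.2.2.1, t.1⟫ ∧ ⟪t.2.2.2, t.1⟫ ≤ ⟪t.2.2.2, p⟫ ∧
      ⟪t.2.2.2, p⟫ ≤ ⟪t.2.2.2, t.2.1⟫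

lemma strict_of_width (P : Set E2) (hPint : (interior P).Nonempty) (x y k : E2) (hk : ‖k‖ = 1)
    (h : ∀ p ∈ P, ⟪k, x⟫ ≤ ⟪k, p⟫ ∧ ⟪k, p⟫ ≤ ⟪k, y⟫) : ⟪k, x⟫ < ⟪k, y⟫ := by
  obtain ⟨z, hz⟩ := hPint
  obtain ⟨ε, hε, hb⟩ := Metric.isOpen_iff.1 isOpen_interior z hz
  have h1 : z + (ε / 2) • k ∈ P := by
    apply interior_subset
    apply hb
    simp [norm_smul, hk, abs_of_pos hε]
    linarith
  have h2 := (h _ h1).2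
  have h3 := (h _ (interior_subset hz)).1
  rw [inner_add_right, inner_smul_right, real_inner_self_eq_norm_sq, hk] at h2
  linarith

lemma exists_width (P : Set E2) (hPcomp : IsCompact P) (hPconv : Convex ℝ P)
    (hPint : (interior P).Nonempty) (x y : E2) (h : IsMaxSeg P x y) :
    ∃ k : E2, ‖k‖ = 1 ∧ ∀ p ∈ P, ⟪k, x⟫ ≤ ⟪k, p⟫ ∧ ⟪k, p⟫ ≤ ⟪k, y⟫ := by
  obtain ⟨hseg, hmax⟩ := h
  have hx : x ∈ P := hseg (left_mem_segment ℝ x y)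
  have hy : y ∈ P := hseg (right_mem_segment ℝ x y)
  have hdisj : Disjoint (interior P) ((y - x) +ᵥ P) := by
    rw [Set.disjoint_left]
    rintro z hz ⟨q, hq, rfl⟩
    apply hmax
    simp only [vadd_eq_add] at hz
    have hcont : Tendsto (fun e : ℝ => y - x + q + e • (y - x)) (𝓝[>] 0) (𝓝 (y - x + q)) := by
      have : Continuous (fun e : ℝ => y - x + q + e • (y - x)) := by fun_prop
      have h2 := this.tendsto 0
      simp only [zero_smul, add_zero] at h2
      exact h2.mono_left nhdsWithin_le_nhds
    have hev := hcont.eventually (isOpen_interior.mem_nhds hz)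
    obtain ⟨e, he, hepos⟩ := (hev.and self_mem_nhdsWithin).exists
    replace hz : y - x + q ∈ interior P := hz
    refine ⟨q - (1 + e) • x, 1 + e, by linarith, ?_⟩
    rintro _ ⟨_, ⟨_, ⟨a, b, ha, hb, hab, rfl⟩, rfl⟩, rfl⟩
    have := hPconv hq (interior_subset he) ha hb hab
    convert this using 1
    have ha' : a = 1 - b := by linarith
    subst ha'
    simp only [vadd_eq_add]
    module
  obtain ⟨f, u, hf1, hf2⟩ := geometric_hahn_banach_open hPconv.interior isOpen_interior
    (hPconv.vadd (y - x)) hdisj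
  have hcl : ∀ p ∈ P, f p ≤ u := by
    intro p hp
    have h1 : p ∈ closure (interior P) := by
      rw [hPconv.closure_interior_eq_closure_of_nonempty_interior hPint]
      exact subset_closure hp
    have h2 : closure (interior P) ⊆ {p | f p ≤ u} :=
      closure_minimal (fun p hp => (hf1 p hp).le) (isClosed_le (by fun_prop) (by fun_prop))
    exact h2 h1
  have hq : ∀ q ∈ P, u ≤ f y - f x + f q := by
    intro q hq
    have := hf2 ((y - x) +ᵥ q) (Set.vadd_mem_vadd_set hq)
    simpa using this
  obtain ⟨v, hv⟩ := (InnerProductSpace.toDual ℝ E2).surjective f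
  have hfv : ∀ p, f p = ⟪v, p⟫ := by
    intro p; rw [← hv]; simp
  have hv0 : v ≠ 0 := by
    rintro rfl
    obtain ⟨z, hz⟩ := hPint
    have h1 := hf1 z hz
    have h2 := hq z (interior_subset hz)
    simp [hfv] at h1 h2
    linarith
  have hpos : 0 < ‖v‖⁻¹ := by positivity
  refine ⟨‖v‖⁻¹ • v, by simp [norm_smul, hv0], fun p hp => ?_⟩
  simp only [real_inner_smul_left, ← hfv]
  constructor
  · apply mul_le_mul_of_nonneg_left _ hpos.le
    linarith [hcl y hy, hq p hp]
  · apply mul_le_mul_of_nonneg_left _ hpos.le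
    linarith [hcl p hp, hq x hx]

lemma max_of_width (P : Set E2) (hPconv : Convex ℝ P)
    (hPint : (interior P).Nonempty) (x y k : E2) (hx : x ∈ P) (hy : y ∈ P) (hk : ‖k‖ = 1)
    (h : ∀ p ∈ P, ⟪k, x⟫ ≤ ⟪k, p⟫ ∧ ⟪k, p⟫ ≤ ⟪k, y⟫) : IsMaxSeg P x y := by
  have hlt := strict_of_width P hPint x y k hk h
  refine ⟨hPconv.segment_subset hx hy, ?_⟩
  rintro ⟨z, s, hs, hsub⟩
  have h1 : z + s • x ∈ P :=
    hsub (Set.vadd_mem_vadd_set (Set.smul_mem_smul_set (left_mem_segment ℝ x y)))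
  have h2 : z + s • y ∈ P :=
    hsub (Set.vadd_mem_vadd_set (Set.smul_mem_smul_set (right_mem_segment ℝ x y)))
  have h3 := (h _ h1).1
  have h4 := (h _ h2).2
  simp only [inner_add_right, inner_smul_right] at h3 h4
  nlinarith

lemma QP_compact (P : Set E2) (hPcomp : IsCompact P) : IsCompact {t | QP P t} := by
  have hS := isCompact_sphere (0 : E2) 1
  refine (hPcomp.prod (hPcomp.prod (hS.prod hS))).of_isClosed_subset ?_ ?_
  · have hc := hPcomp.isClosed
    have : {t | QP P t} = {t : E2 × E2 × E2 × E2 | t.1 ∈ P} ∩ ({t | t.2.1 ∈ P} ∩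
        ({t | ‖t.2.2.1‖ = 1} ∩ ({t | ‖t.2.2.2‖ = 1} ∩ ⋂ p ∈ P, 
        ({t | ⟪t.2.2.1, p⟫ ≤ ⟪t.2.2.1, t.1⟫} ∩ ({t | ⟪t.2.2.2, t.1⟫ ≤ ⟪t.2.2.2, p⟫} ∩
        {t | ⟪t.2.2.2, p⟫ ≤ ⟪t.2.2.2, t.2.1⟫}))))) := by
      ext t
      simp [QP]
    rw [this]
    refine (hc.preimage (by fun_prop)).inter ((hc.preimage (by fun_prop)).inter
      ((isClosed_eq (by fun_prop) (by fun_prop)).inter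
      ((isClosed_eq (by fun_prop) (by fun_prop)).inter (isClosed_biInter fun p _ => ?_))))
    exact (isClosed_le (by fun_prop) (by fun_prop)).inter
      ((isClosed_le (by fun_prop) (by fun_prop)).inter (isClosed_le (by fun_prop) (by fun_prop)))
  · rintro ⟨x, y, a, k⟩ ⟨h1, h2, h3, h4, -⟩
    simp_all

lemma plane_alg (a k w e : E2) (ha : a ≠ 0) (hw : w ≠ 0) (h1 : ⟪a, w⟫ = 0) (h2 : ⟪k, w⟫ = 0)
    (h3 : ⟪a, e⟫ = 0) : ⟪k, e⟫ = 0 := by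
  simp only [PiLp.inner_apply, Fin.sum_univ_two, RCLike.inner_apply, conj_trivial] at *
  have hw' : w 0 ≠ 0 ∨ w 1 ≠ 0 := by
    by_contra! hc
    apply hw
    ext i
    fin_cases i <;> simp [hc]
  have ha' : a 0 ≠ 0 ∨ a 1 ≠ 0 := by
    by_contra! hc
    apply ha
    ext i
    fin_cases i <;> simp [hc]
  have hd : a 0 * k 1 - a 1 * k 0 = 0 := by
    rcases hw' with h | h
    · apply mul_left_cancel₀ h
      linear_combination k 1 * h1 - a 1 * h2
    · apply mul_left_cancel₀ h
      linear_combination a 0 * h2 - k 0 * h1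
  rcases ha' with h | h
  · apply mul_left_cancel₀ h
    linear_combination k 0 * h3 + e 1 * hd
  · apply mul_left_cancel₀ h
    linear_combination k 1 * h3 - e 0 * hd

def FP (P : Set E2) : Set E2 := {x | ∃ y a k, QP P (x, y, a, k) ∧ ⟪y - x, a⟫ = 0}

lemma core (P : Set E2) (hPcomp : IsCompact P) (hPint : (interior P).Nonempty)
    (t : ℕ → E2 × E2 × E2 × E2) (ht : ∀ n, QP P (t n))
    (hlim : Tendsto (fun n => ⟪(t n).2.1 - (t n).1, (t n).2.2.1⟫) atTop (𝓝 0)) :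
    ∃ x ∈ FP P, ∃ᶠ n in atTop, (t n).1 = x := by
  obtain ⟨⟨x, y, a, k⟩, hQ, φ, hφ, hφt⟩ := (QP_compact P hPcomp).tendsto_subseq ht
  have hT : Tendsto φ atTop atTop := hφ.tendsto_atTop
  have h0 : ⟪y - x, a⟫ = 0 := by
    have hc : Continuous (fun t : E2 × E2 × E2 × E2 => ⟪t.2.1 - t.1, t.2.2.1⟫) := by fun_prop
    exact tendsto_nhds_unique ((hc.tendsto _).comp hφt) (hlim.comp hT)
  refine ⟨x, ⟨y, a, k, hQ, h0⟩, ?_⟩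
  by_contra hcon
  rw [not_frequently] at hcon
  have hne : ∀ᶠ n in atTop, (t (φ n)).1 ≠ x := hT.eventually hcon
  obtain ⟨N, hN⟩ := eventually_atTop.1 hne
  let w : ℕ → E2 := fun n => ‖(t (φ (n + N))).1 - x‖⁻¹ • ((t (φ (n + N))).1 - x)
  have hw : ∀ n, w n ∈ Metric.sphere (0 : E2) 1 := by
    intro n
    have := hN (n + N) (by omega)
    simp [w, norm_smul, sub_eq_zero, this]
  obtain ⟨v, hv, ψ, hψ, hψt⟩ := (isCompact_sphere (0 : E2) 1).tendsto_subseq hw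
  have hv1 : v ≠ 0 := by
    rintro rfl
    simp at hv
  have hsub : Tendsto (fun n => t (φ (ψ n + N))) atTop (𝓝 (x, y, a, k)) :=
    hφt.comp ((tendsto_add_atTop_nat N).comp hψ.tendsto_atTop)
  have hA : Tendsto (fun n => (t (φ (ψ n + N))).2.2.1) atTop (𝓝 a) :=
    ((by fun_prop : Continuous fun t : E2 × E2 × E2 × E2 => t.2.2.1).tendsto _).comp hsub
  have hK : Tendsto (fun n => (t (φ (ψ n + N))).2.2.2) atTop (𝓝 k) :=
    ((by fun_prop : Continuous fun t : E2 × E2 × E2 × E2 => t.2.2.2).tendsto _).comp hsub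
  have hψt' : Tendsto (fun n => w (ψ n)) atTop (𝓝 v) := hψt
  obtain ⟨hx, hy, ha, hk, hall⟩ := hQ
  simp only at hx hy ha hk hall
  have hnn : ∀ n, 0 ≤ ‖(t (φ (ψ n + N))).1 - x‖⁻¹ := fun n => by positivity
  have e1 : 0 ≤ ⟪a, v⟫ := by
    refine ge_of_tendsto' (hA.inner hψt') fun n => ?_
    have := ((ht (φ (ψ n + N))).2.2.2.2 x hx).1
    simp only [w, inner_smul_right, inner_sub_right]
    exact mul_nonneg (hnn n) (by linarith)
  have e2 : ⟪a, v⟫ ≤ 0 := by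
    refine le_of_tendsto' (tendsto_const_nhds.inner hψt') fun n => ?_
    have := (hall _ (ht (φ (ψ n + N))).1).1
    simp only [w, inner_smul_right, inner_sub_right]
    exact mul_nonpos_of_nonneg_of_nonpos (hnn n) (by linarith)
  have e3 : ⟪k, v⟫ ≤ 0 := by
    refine le_of_tendsto' (hK.inner hψt') fun n => ?_
    have := ((ht (φ (ψ n + N))).2.2.2.2 x hx).2.1
    simp only [w, inner_smul_right, inner_sub_right]
    exact mul_nonpos_of_nonneg_of_nonpos (hnn n) (by linarith)
  have e4 : 0 ≤ ⟪k, v⟫ := by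
    refine ge_of_tendsto' (tendsto_const_nhds.inner hψt') fun n => ?_
    have := (hall _ (ht (φ (ψ n + N))).1).2.1
    simp only [w, inner_smul_right, inner_sub_right]
    exact mul_nonneg (hnn n) (by linarith)
  have ha0 : a ≠ 0 := by
    rintro rfl
    simp at ha
  have hz := plane_alg a k v (y - x) ha0 hv1 (le_antisymm e2 e1) (le_antisymm e3 e4)
    (by rw [real_inner_comm]; exact h0)
  have := strict_of_width P hPint x y k hk (fun p hp => (hall p hp).2)
  rw [inner_sub_right] at hz
  linarith

lemma FP_finite (P : Set E2) (hPcomp : IsCompact P) (hPint : (interior P).Nonempty) :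
    (FP P).Finite := by
  by_contra hinf
  have hinf : (FP P).Infinite := hinf
  let s := hinf.natEmbedding
  have hs : ∀ n, ∃ y a k, QP P ((s n : E2), y, a, k) ∧ ⟪y - (s n : E2), a⟫ = 0 := fun n => (s n).2
  choose y a k h1 h2 using hs
  obtain ⟨x, -, hf⟩ := core P hPcomp hPint (fun n => ((s n : E2), y n, a n, k n)) h1
    (by simp only [h2]; exact tendsto_const_nhds)
  obtain ⟨n, hn⟩ := hf.exists
  obtain ⟨m, hm, hm'⟩ := (hf.and_eventually (eventually_gt_atTop n)).exists
  have : s m = s n := Subtype.ext (hm.trans hn.symm)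
  have := s.injective this
  omega

/-- **Lemma.** Let `P ⊆ ℝ²` be compact and convex with nonempty interior.  Then there are
`δ > 0` and a finite `F ⊆ ∂P` such that `δ_P(x) > δ` for all `x ∈ ∂P \ F` (every maximal
segment with endpoint `x` makes angle `> δ` with every supporting line of `P` at `x`), and
`δ_P(x) = 0` for all `x ∈ F`. -/
theorem deltaP_finite_exceptional (P : Set (EuclideanSpace ℝ (Fin 2)))
    (hPcomp : IsCompact P) (hPconv : Convex ℝ P) (hPint : (interior P).Nonempty) :
    ∃ (δ : ℝ) (F : Finset (EuclideanSpace ℝ (Fin 2))), 0 < δ ∧ ↑F ⊆ frontier P ∧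
      (∀ x ∈ frontier P \ ↑F, ∀ y : EuclideanSpace ℝ (Fin 2), IsMaxSeg P x y →
        ∀ (a : EuclideanSpace ℝ (Fin 2)) (b : ℝ), IsSuppHyperplaneAt P x a b →
          δ < |⟪‖y - x‖⁻¹ • (y - x), a⟫|) ∧
      (∀ x ∈ (F : Set (EuclideanSpace ℝ (Fin 2))), ∀ ε : ℝ, 0 < ε →
        ∃ (y a : EuclideanSpace ℝ (Fin 2)) (b : ℝ), IsMaxSeg P x y ∧
          IsSuppHyperplaneAt P x a b ∧ |⟪‖y - x‖⁻¹ • (y - x), a⟫| < ε) := by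
  classical
  have hfin := FP_finite P hPcomp hPint
  have hcoe : (hfin.toFinset : Set (EuclideanSpace ℝ (Fin 2))) = FP P := hfin.coe_toFinset
  obtain ⟨C, hC⟩ := hPcomp.isBounded.exists_norm_le
  have key : ∃ δ : ℝ, 0 < δ ∧ ∀ x y a k : E2, x ∉ FP P → QP P (x, y, a, k) →
      δ < |⟪‖y - x‖⁻¹ • (y - x), a⟫| := by
    by_contra! hcon
    have hc := fun n : ℕ => hcon (1 / ((n : ℝ) + 1)) (by positivity)
    choose x y a k h1 h2 h3 using hc
    obtain ⟨z, hz, hf⟩ := core P hPcomp hPint (fun n => (x n, y n, a n, k n)) h2 (by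
      have hl : Tendsto (fun n : ℕ => (C + C) * (1 / ((n : ℝ) + 1))) atTop (𝓝 0) := by
        simpa using (tendsto_one_div_add_atTop_nhds_zero_nat (𝕜 := ℝ)).const_mul (C + C)
      refine squeeze_zero_norm (fun n => ?_) hl
      have hxy := strict_of_width P hPint (x n) (y n) (k n) (h2 n).2.2.2.1
        (fun p hp => ((h2 n).2.2.2.2 p hp).2)
      have hne : y n - x n ≠ 0 := by
        intro h
        rw [sub_eq_zero.1 h] at hxy
        exact lt_irrefl _ hxy
      have hpos : 0 < ‖y n - x n‖ := norm_pos_iff.2 hne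
      have hle : ‖y n - x n‖ ≤ C + C :=
        (norm_sub_le _ _).trans (add_le_add (hC _ (h2 n).2.1) (hC _ (h2 n).1))
      have h4 := h3 n
      rw [real_inner_smul_left, abs_mul, abs_of_pos (inv_pos.2 hpos)] at h4
      rw [Real.norm_eq_abs]
      calc |⟪y n - x n, a n⟫| = ‖y n - x n‖ * (‖y n - x n‖⁻¹ * |⟪y n - x n, a n⟫|) := by
            field_simp
        _ ≤ (C + C) * (1 / ((n : ℝ) + 1)) :=
            mul_le_mul hle h4 (by positivity) (by linarith))
    obtain ⟨n, hn⟩ := hf.exists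
    exact h1 n (by simpa [← hn] using hz)
  obtain ⟨δ, hδ, hkey⟩ := key
  refine ⟨δ, hfin.toFinset, hδ, ?_, ?_, ?_⟩
  · rw [hcoe]
    rintro x ⟨y, a, k, ⟨hx, hy, ha, hk, hall⟩, h0⟩
    simp only at hx hy ha hk hall
    refine ⟨subset_closure hx, fun hi => ?_⟩
    obtain ⟨ε, hε, hb⟩ := Metric.isOpen_iff.1 isOpen_interior x hi
    have h1 : x + (ε / 2) • a ∈ P := by
      apply interior_subset
      apply hb
      simp [norm_smul, ha, abs_of_pos hε]
      linarith
    have h2 := (hall _ h1).1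
    rw [inner_add_right, inner_smul_right, real_inner_self_eq_norm_sq, ha] at h2
    linarith
  · rw [hcoe]
    rintro x ⟨-, hx⟩ y hm a b ⟨ha, rfl, hb⟩
    obtain ⟨k, hk, hw⟩ := exists_width P hPcomp hPconv hPint x y hm
    exact hkey x y a k hx ⟨hm.1 (left_mem_segment ℝ x y), hm.1 (right_mem_segment ℝ x y), ha, hk,
      fun p hp => ⟨hb p hp, hw p hp⟩⟩
  · rw [hcoe]
    rintro x ⟨y, a, k, ⟨hx, hy, ha, hk, hall⟩, h0⟩ ε hε
    refine ⟨y, a, ⟪a, x⟫, max_of_width P hPconv hPint x y k hx hy hk (fun p hp => (hall p hp).2),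
      ⟨ha, rfl, fun p hp => (hall p hp).1⟩, ?_⟩
    rw [real_inner_smul_left, h0]
    simpa using hε
end

section
/- Let P ⊆ ℝ^d be compact and convex with 0 in its interior. Let B ⊆ ∂P be compact and suppose there exist s ∈ ℝ^d and t ∈ (0, 1) with B ⊆ s + t • P. Then there is an open neighborhood U of B such that for every ε ∈ (0, 1), U ∩ P is contained in the interior of ε • s + P. -/
open Pointwise Set

/-- **Lemma.** Let `P ⊆ ℝ^d` be compact and convex with `0` in its interior.  Let `B ⊆ ∂P`
be compact and suppose `B ⊆ s + t • P` for some `s ∈ ℝ^d` and `t ∈ (0, 1)`.  Then there is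
an open neighborhood `U` of `B` such that for every `ε ∈ (0, 1)`, `U ∩ P` is contained in
the interior of `ε • s + P`. -/
theorem neighborhood_in_translate (d : ℕ) (P : Set (EuclideanSpace ℝ (Fin d)))
    (hPcomp : IsCompact P) (hPconv : Convex ℝ P) (h0 : (0 : EuclideanSpace ℝ (Fin d)) ∈ interior P)
    (B : Set (EuclideanSpace ℝ (Fin d))) (hBsub : B ⊆ frontier P) (hBcomp : IsCompact B)
    (s : EuclideanSpace ℝ (Fin d)) (t : ℝ) (ht : t ∈ Set.Ioo (0 : ℝ) 1)
    (hcov : B ⊆ s +ᵥ t • P) :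
    ∃ U : Set (EuclideanSpace ℝ (Fin d)), IsOpen U ∧ B ⊆ U ∧
      ∀ ε ∈ Set.Ioo (0 : ℝ) 1, U ∩ P ⊆ interior ((ε • s) +ᵥ P) := by
  refine ⟨s +ᵥ interior P, isOpen_interior.vadd s, ?_, ?_⟩
  · intro b hb
    obtain ⟨y, ⟨z, hz, rfl⟩, rfl⟩ := hcov hb
    refine ⟨t • z, ?_, rfl⟩
    have h := hPconv.combo_self_interior_mem_interior hz h0 ht.1.le
      (sub_pos.2 ht.2) (by ring)
    simpa using h
  · rintro ε hε x ⟨⟨y, hy, rfl⟩, hx⟩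
    rw [interior_vadd]
    have h := hPconv.combo_self_interior_mem_interior hx hy (sub_pos.2 hε.2).le hε.1 (by ring)
    refine ⟨_, h, ?_⟩
    simp only [vadd_eq_add]
    module
end

section
/- Let P ⊆ ℝ^d be compact and convex with nonempty interior, let s ∈ ℝ^d and t ∈ (0, 1), let Q = s + t • P, and suppose Q ⊆ P and ∂Q ∩ ∂P ≠ ∅. Then: (i) if P is strictly convex, ∂Q ∩ ∂P consists of exactly one point; (ii) if d = 2, there exist two supporting lines L₁ and L₂ of P with ∂Q ∩ ∂P ⊆ L₁ ∪ L₂. -/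
open Pointwise Set RealInnerProductSpace

lemma support_aux {d : ℕ} {P : Set (EuclideanSpace ℝ (Fin d))}
    (hPconv : Convex ℝ P) (hPint : (interior P).Nonempty)
    {z : EuclideanSpace ℝ (Fin d)} (hz : z ∈ frontier P) :
    ∃ a : EuclideanSpace ℝ (Fin d), a ≠ 0 ∧ ∀ y ∈ P, ⟪a, y⟫ ≤ ⟪a, z⟫ := by
  obtain ⟨f, hf⟩ := geometric_hahn_banach_open_point hPconv.interior isOpen_interior hz.2
  have h : ∀ y, ⟪(InnerProductSpace.toDual ℝ _).symm f, y⟫ = f y := fun y => by simp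
  refine ⟨(InnerProductSpace.toDual ℝ _).symm f, ?_, ?_⟩
  · intro h0
    obtain ⟨y, hy⟩ := hPint
    have := hf y hy
    rw [← h, ← h, h0] at this
    simp at this
  · intro y hy
    rw [h, h]
    have hcl : y ∈ closure (interior P) := by
      rw [hPconv.closure_interior_eq_closure_of_nonempty_interior hPint]
      exact subset_closure hy
    have hc : IsClosed {y | f y ≤ f z} := isClosed_le f.continuous continuous_const
    exact closure_minimal (fun y hy => (hf y hy).le) hc hcl

lemma plane_aux {a b x y x' y' : ℝ} (hu : ¬ (x = 0 ∧ y = 0)) (h1 : a * x + b * y = 0)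
    (h2 : a * x' + b * y' < 0) : x * y' - y * x' ≠ 0 := by
  intro hD
  apply hu
  constructor
  · have : x * (a * x' + b * y') = 0 := by linear_combination x' * h1 + b * hD
    exact (mul_eq_zero.1 this).resolve_right h2.ne
  · have : y * (a * x' + b * y') = 0 := by linear_combination y' * h1 - a * hD
    exact (mul_eq_zero.1 this).resolve_right h2.ne

lemma plane_zero {a b x y x' y' : ℝ} (hD : x * y' - y * x' ≠ 0) (h1 : a * x + b * y = 0)
    (h2 : a * x' + b * y' = 0) : a = 0 ∧ b = 0 := by
  constructor
  · have : a * (x * y' - y * x') = 0 := by linear_combination y' * h1 - y * h2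
    exact (mul_eq_zero.1 this).resolve_right hD
  · have : b * (x * y' - y * x') = 0 := by linear_combination x * h2 - x' * h1
    exact (mul_eq_zero.1 this).resolve_right hD

lemma plane_key {a b x y a' b' x' y' a₃ b₃ x₃ y₃ : ℝ} (hu : ¬ (x = 0 ∧ y = 0))
    (h' : ¬ (a' = 0 ∧ b' = 0)) (h₃ : ¬ (a₃ = 0 ∧ b₃ = 0))
    (h11 : a * x + b * y = 0) (h12 : a * x' + b * y' < 0) (h13 : a * x₃ + b * y₃ ≤ 0)
    (h21 : a' * x + b' * y ≤ 0) (h22 : a' * x' + b' * y' = 0) (h23 : a' * x₃ + b' * y₃ ≤ 0)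
    (h31 : a₃ * x + b₃ * y ≤ 0) (h32 : a₃ * x' + b₃ * y' ≤ 0) (h33 : a₃ * x₃ + b₃ * y₃ = 0) :
    a * x₃ + b * y₃ = 0 ∨ a' * x₃ + b' * y₃ = 0 := by
  have hD := plane_aux hu h11 h12
  have h21' : a' * x + b' * y < 0 :=
    lt_of_le_of_ne h21 fun h => h' (plane_zero hD h h22)
  obtain ⟨α, β, hx, hy⟩ : ∃ α β : ℝ, x₃ = α * x + β * x' ∧ y₃ = α * y + β * y' := by
    refine ⟨(x₃ * y' - y₃ * x') / (x * y' - y * x'),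
      (x * y₃ - y * x₃) / (x * y' - y * x'), ?_, ?_⟩ <;>
    rw [div_mul_eq_mul_div, div_mul_eq_mul_div, ← add_div, eq_div_iff hD] <;> ring
  have e1 : a * x₃ + b * y₃ = β * (a * x' + b * y') := by
    rw [hx, hy]; linear_combination α * h11
  have e2 : a' * x₃ + b' * y₃ = α * (a' * x + b' * y) := by
    rw [hx, hy]; linear_combination β * h22
  have e3 : α * (a₃ * x + b₃ * y) + β * (a₃ * x' + b₃ * y') = 0 := by
    rw [← h33, hx, hy]; ring
  have hβ : 0 ≤ β := by by_contra! h; nlinarith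
  have hα : 0 ≤ α := by by_contra! h; nlinarith
  rcases hβ.eq_or_lt with h | hβ
  · left; rw [e1, ← h]; ring
  rcases hα.eq_or_lt with h | hα
  · right; rw [e2, ← h]; ring
  exfalso
  apply h₃
  have k1 := mul_nonpos_of_nonneg_of_nonpos hα.le h31
  have k2 := mul_nonpos_of_nonneg_of_nonpos hβ.le h32
  have m1 : α * (a₃ * x + b₃ * y) = 0 := by linarith
  have m2 : β * (a₃ * x' + b₃ * y') = 0 := by linarith
  exact plane_zero hD ((mul_eq_zero.1 m1).resolve_left hα.ne')
    ((mul_eq_zero.1 m2).resolve_left hβ.ne')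


/-- **Lemma.** Let `P ⊆ ℝ^d` be compact and convex with nonempty interior, let `Q = s + t•P`
with `t ∈ (0,1)`, `Q ⊆ P` and `∂Q ∩ ∂P ≠ ∅`.  Then: (i) if `P` is strictly convex,
`∂Q ∩ ∂P` is a single point; (ii) if `d = 2`, `∂Q ∩ ∂P` is contained in the union of two
supporting lines of `P`. -/
theorem frontier_inter_frontier (d : ℕ) (P : Set (EuclideanSpace ℝ (Fin d)))
    (hPcomp : IsCompact P) (hPconv : Convex ℝ P) (hPint : (interior P).Nonempty)
    (s : EuclideanSpace ℝ (Fin d)) (t : ℝ) (ht : t ∈ Set.Ioo (0 : ℝ) 1)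
    (Q : Set (EuclideanSpace ℝ (Fin d))) (hQ : Q = s +ᵥ t • P) (hQP : Q ⊆ P)
    (hne : (frontier Q ∩ frontier P).Nonempty) :
    (StrictConvex ℝ P → ∃ z, frontier Q ∩ frontier P = {z}) ∧
    (d = 2 → ∃ (a₁ a₂ : EuclideanSpace ℝ (Fin d)) (b₁ b₂ : ℝ),
      a₁ ≠ 0 ∧ a₂ ≠ 0 ∧
      (∀ z ∈ P, ⟪a₁, z⟫ ≤ b₁) ∧ (∃ w ∈ frontier P, ⟪a₁, w⟫ = b₁) ∧
      (∀ z ∈ P, ⟪a₂, z⟫ ≤ b₂) ∧ (∃ w ∈ frontier P, ⟪a₂, w⟫ = b₂) ∧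
      frontier Q ∩ frontier P ⊆ {z | ⟪a₁, z⟫ = b₁} ∪ {z | ⟪a₂, z⟫ = b₂}) := by
  obtain ⟨ht0, ht1⟩ := ht
  have hcl : IsClosed P := hPcomp.isClosed
  have hQmem : ∀ x ∈ P, s + t • x ∈ Q := by
    intro x hx
    rw [hQ]
    exact ⟨t • x, ⟨x, hx, rfl⟩, rfl⟩
  have hQcl : IsClosed Q := by
    rw [hQ]
    exact ((hPcomp.smul t).vadd s).isClosed
  obtain ⟨c, hc⟩ : ∃ c, c = (1 - t)⁻¹ • s := ⟨_, rfl⟩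
  have hs : s = (1 - t) • c := by
    rw [hc, smul_inv_smul₀ (by linarith)]
  have hcP : c ∈ P := by
    obtain ⟨p, hp⟩ := hPint
    have hp : p ∈ P := interior_subset hp
    have hit : ∀ n : ℕ, c + t ^ n • (p - c) ∈ P := by
      intro n
      induction n with
      | zero => simpa using hp
      | succ n ih =>
        have := hQP (hQmem _ ih)
        convert this using 1
        rw [hs, pow_succ]
        module
    have hlim : Filter.Tendsto (fun n : ℕ => c + t ^ n • (p - c)) Filter.atTop
        (nhds (c + (0 : ℝ) • (p - c))) :=
      ((tendsto_pow_atTop_nhds_zero_of_lt_one ht0.le ht1).smul_const _).const_add _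
    have := hcl.mem_of_tendsto hlim (Filter.Eventually.of_forall hit)
    simpa using this
  have hS : ∀ z ∈ frontier Q ∩ frontier P, ∃ x ∈ P, z = (1 - t) • c + t • x := by
    rintro z ⟨hz, -⟩
    have hzQ : z ∈ Q := hQcl.frontier_subset hz
    rw [hQ] at hzQ
    obtain ⟨_, ⟨x, hx, rfl⟩, rfl⟩ := hzQ
    exact ⟨x, hx, by simp [hs]⟩
  have hcf : c ∈ frontier P := by
    refine ⟨subset_closure hcP, fun hci => ?_⟩
    obtain ⟨z, hz⟩ := hne
    obtain ⟨x, hx, rfl⟩ := hS z hz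
    exact hz.2.2 (hPconv.combo_interior_self_mem_interior hci hx (by linarith) ht0.le (by ring))
  constructor
  · intro hstr
    have hall : ∀ z ∈ frontier Q ∩ frontier P, z = c := by
      intro z hz
      obtain ⟨x, hx, rfl⟩ := hS z hz
      by_cases hxc : c = x
      · subst hxc; module
      · exact absurd (hstr hcP hx hxc (by linarith) ht0 (by ring)) hz.2.2
    refine ⟨c, Set.eq_singleton_iff_nonempty_unique_mem.2 ⟨hne, hall⟩⟩
  · intro hd
    subst hd
    have hsup : ∀ z ∈ frontier Q ∩ frontier P, ∃ a : EuclideanSpace ℝ (Fin 2), a ≠ 0 ∧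
        (∀ y ∈ P, ⟪a, y⟫ ≤ ⟪a, c⟫) ∧ ⟪a, z⟫ = ⟪a, c⟫ := by
      intro z hz
      obtain ⟨a, ha, hle⟩ := support_aux hPconv hPint hz.2
      obtain ⟨x, hx, hzx⟩ := hS z hz
      have h1 := hle c hcP
      have h2 := hle x hx
      have h3 : ⟪a, z⟫ = (1 - t) * ⟪a, c⟫ + t * ⟪a, x⟫ := by
        rw [hzx, inner_add_right, inner_smul_right, inner_smul_right]
      have h4 : ⟪a, z⟫ = ⟪a, c⟫ := by nlinarith
      exact ⟨a, ha, fun y hy => h4 ▸ hle y hy, h4⟩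
    have hSP : ∀ z ∈ frontier Q ∩ frontier P, z ∈ P := fun z hz => hcl.frontier_subset hz.2
    by_cases hex : ∃ z ∈ frontier Q ∩ frontier P, z ≠ c
    · obtain ⟨z₁, hz₁, hne₁⟩ := hex
      obtain ⟨a₁, ha₁, hle₁, he₁⟩ := hsup z₁ hz₁
      by_cases hall : ∀ z ∈ frontier Q ∩ frontier P, ⟪a₁, z⟫ = ⟪a₁, c⟫
      · exact ⟨a₁, a₁, _, _, ha₁, ha₁, hle₁, ⟨c, hcf, rfl⟩, hle₁, ⟨c, hcf, rfl⟩,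
          fun z hz => Or.inl (hall z hz)⟩
      · push Not at hall
        obtain ⟨z₂, hz₂, hne₂⟩ := hall
        obtain ⟨a₂, ha₂, hle₂, he₂⟩ := hsup z₂ hz₂
        refine ⟨a₁, a₂, _, _, ha₁, ha₂, hle₁, ⟨c, hcf, rfl⟩, hle₂, ⟨c, hcf, rfl⟩,
          fun z hz => ?_⟩
        obtain ⟨a₃, ha₃, hle₃, he₃⟩ := hsup z hz
        have hlt := lt_of_le_of_ne (hle₁ _ (hSP _ hz₂)) hne₂
        have q13 := hle₁ _ (hSP _ hz)
        have q21 := hle₂ _ (hSP _ hz₁)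
        have q23 := hle₂ _ (hSP _ hz)
        have q31 := hle₃ _ (hSP _ hz₁)
        have q32 := hle₃ _ (hSP _ hz₂)
        have hin : ∀ a b : EuclideanSpace ℝ (Fin 2), ⟪a, b⟫ = a 0 * b 0 + a 1 * b 1 := by
          intro a b
          simp [PiLp.inner_apply, Fin.sum_univ_two, mul_comm]
        have hnz : ∀ a : EuclideanSpace ℝ (Fin 2), a ≠ 0 → ¬ (a 0 = 0 ∧ a 1 = 0) := by
          rintro a ha ⟨h0, h1⟩
          apply ha
          ext i
          fin_cases i <;> simp [h0, h1]
        have hu := hnz (z₁ - c) (sub_ne_zero.2 hne₁)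
        simp only [PiLp.sub_apply] at hu
        simp only [hin] at *
        have := plane_key (a := a₁ 0) (b := a₁ 1) (a' := a₂ 0) (b' := a₂ 1)
          (a₃ := a₃ 0) (b₃ := a₃ 1) (x' := z₂ 0 - c 0) (y' := z₂ 1 - c 1)
          (x₃ := z 0 - c 0) (y₃ := z 1 - c 1) hu (hnz _ ha₂) (hnz _ ha₃)
          (by linarith) (by linarith) (by linarith) (by linarith) (by linarith) (by linarith)
          (by linarith) (by linarith) (by linarith)
        rcases this with h | h
        · left
          simp only [Set.mem_setOf_eq, hin]
          linarith
        · right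
          simp only [Set.mem_setOf_eq, hin]
          linarith
    · push Not at hex
      obtain ⟨a, ha, hle⟩ := support_aux hPconv hPint hcf
      exact ⟨a, a, _, _, ha, ha, hle, ⟨c, hcf, rfl⟩, hle, ⟨c, hcf, rfl⟩,
          fun z hz => Or.inl (by rw [hex z hz]; rfl)⟩
end

section
/- Let H be a real Hilbert space and let (e_u), indexed by the finite sequences u of elements of {−1, 1}, be an orthonormal family in H. Define π : {−1, 1}^ℕ → H by π(x) = Σ_{n ∈ ℕ} 2^{−n} x(n) e_{x↾n}, where x↾n = (x(0), …, x(n−1)) (the series converges in H since its coefficients are square-summable), and let K = π({−1, 1}^ℕ). Then for every y ∈ H and every ρ > 0: if y lies in the convex hull of K ∩ S(y, ρ), where S(y, ρ) is the sphere of radius ρ centered at y, then K ∩ B(y, ρ) = ∅, where B(y, ρ) is the open ball of radius ρ centered at y. -/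
open Set

noncomputable def smTerm {H : Type*} [NormedAddCommGroup H] [InnerProductSpace ℝ H]
    (e : List Bool → H) (x : ℕ → Bool) (n : ℕ) : H :=
  (((2 : ℝ)⁻¹) ^ n * (if x n then 1 else -1)) • e (List.ofFn fun i : Fin n => x i)

lemma smTerm_summable {H : Type*} [NormedAddCommGroup H] [InnerProductSpace ℝ H]
    [CompleteSpace H] (e : List Bool → H) (he : Orthonormal ℝ e) (x : ℕ → Bool) :
    Summable (smTerm e x) := by
  apply Summable.of_norm
  have h : (fun n => ‖smTerm e x n‖) = fun n => ((2 : ℝ)⁻¹) ^ n := by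
    funext n
    rw [smTerm, norm_smul, he.1, norm_mul]
    split_ifs <;> simp
  rw [h]
  exact summable_geometric_of_lt_one (by norm_num) (by norm_num)

lemma smTerm_inner {H : Type*} [NormedAddCommGroup H] [InnerProductSpace ℝ H]
    (e : List Bool → H) (he : Orthonormal ℝ e) (x z : ℕ → Bool) (k n : ℕ) :
    inner ℝ (smTerm e x k) (smTerm e z n) =
      if k = n ∧ ∀ i < k, x i = z i then
        ((4 : ℝ)⁻¹) ^ k * (if x k = z k then 1 else -1) else 0 := by
  rw [smTerm, smTerm, inner_smul_left, inner_smul_right, orthonormal_iff_ite.1 he]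
  by_cases hkn : k = n
  · subst hkn
    have h4 : ((4 : ℝ)⁻¹) ^ k = (2⁻¹) ^ k * (2⁻¹) ^ k := by
      rw [← mul_pow]; norm_num
    have hl : (List.ofFn (fun i : Fin k => x i) = List.ofFn fun i : Fin k => z i) ↔
        ∀ i < k, x i = z i := by
      rw [List.ofFn_inj, funext_iff]
      exact ⟨fun h i hi => h ⟨i, hi⟩, fun h i => h i i.2⟩
    simp only [hl, true_and, h4]
    by_cases h : ∀ i < k, x i = z i
    · rw [if_pos h, if_pos h]
      cases x k <;> cases z k <;> simp
    · rw [if_neg h, if_neg h]; simp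
  · have hl : ¬ (List.ofFn (fun i : Fin k => x i) = List.ofFn fun i : Fin n => z i) := by
      intro h
      apply hkn
      simpa using congrArg List.length h
    rw [if_neg hl]; simp [hkn]

lemma sm_inner {H : Type*} [NormedAddCommGroup H] [InnerProductSpace ℝ H]
    [CompleteSpace H] (e : List Bool → H) (he : Orthonormal ℝ e) (x z : ℕ → Bool) :
    HasSum (fun k => if ∀ i < k, x i = z i then
        ((4 : ℝ)⁻¹) ^ k * (if x k = z k then 1 else -1) else 0)
      (inner ℝ (∑' n, smTerm e x n) (∑' n, smTerm e z n)) := by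
  have hx := (smTerm_summable e he x).hasSum
  have hz := (smTerm_summable e he z).hasSum
  have h1 := (innerSL ℝ (∑' n, smTerm e z n)).hasSum hx
  simp only [innerSL_apply_apply] at h1
  rw [real_inner_comm] at h1
  refine Eq.mp (congrArg (fun f => HasSum f _) (funext fun k => ?_)) h1
  symm
  have h2 := (innerSL ℝ (smTerm e x k)).hasSum hz
  simp only [innerSL_apply_apply] at h2
  rw [real_inner_comm]
  refine HasSum.unique ?_ h2
  have h3 : inner ℝ (smTerm e x k) (smTerm e z k) = if ∀ i < k, x i = z i then
        ((4 : ℝ)⁻¹) ^ k * (if x k = z k then 1 else -1) else 0 := by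
    rw [smTerm_inner e he]; simp
  rw [← h3]
  refine hasSum_single (f := fun n => (inner ℝ (smTerm e x k) (smTerm e z n) : ℝ)) k ?_
  · intro n hn
    rw [smTerm_inner e he, if_neg (fun h => hn h.1.symm)]

lemma sm_self {H : Type*} [NormedAddCommGroup H] [InnerProductSpace ℝ H]
    [CompleteSpace H] (e : List Bool → H) (he : Orthonormal ℝ e) (x : ℕ → Bool) :
    inner ℝ (∑' n, smTerm e x n) (∑' n, smTerm e x n) = (4 / 3 : ℝ) := by
  refine (sm_inner e he x x).unique ?_
  have := hasSum_geometric_of_lt_one (r := (4 : ℝ)⁻¹) (by norm_num) (by norm_num)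
  convert this using 1
  · simp
  · norm_num

lemma sm_ne {H : Type*} [NormedAddCommGroup H] [InnerProductSpace ℝ H]
    [CompleteSpace H] (e : List Bool → H) (he : Orthonormal ℝ e) (x z : ℕ → Bool)
    (hxz : x ≠ z) :
    inner ℝ (∑' n, smTerm e x n) (∑' n, smTerm e z n) =
      (4 / 3 - 7 / 3 * (4 : ℝ)⁻¹ ^ (PiNat.firstDiff x z) : ℝ) := by
  have hd := PiNat.apply_firstDiff_ne hxz
  have hlt : ∀ i < PiNat.firstDiff x z, x i = z i := fun i hi =>
    PiNat.apply_eq_of_lt_firstDiff hi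
  generalize PiNat.firstDiff x z = m at *
  refine (sm_inner e he x z).unique ?_
  have := hasSum_sum_of_ne_finset_zero (L := SummationFilter.unconditional ℕ) (s := Finset.range (m + 1)) (f := fun k =>
    if ∀ i < k, x i = z i then
        ((4 : ℝ)⁻¹) ^ k * (if x k = z k then 1 else -1) else 0) (by
      intro k hk
      rw [if_neg]
      intro h
      exact hd (h m (by simpa using hk)))
  convert this using 1
  rw [Finset.sum_range_succ, if_pos hlt, if_neg hd,
    Finset.sum_congr rfl (g := fun k => ((4 : ℝ)⁻¹) ^ k), geom_sum_eq (by norm_num)]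
  · ring
  · intro k hk
    have hk := Finset.mem_range.1 hk
    rw [if_pos (fun i hi => hlt i (hi.trans hk)), if_pos (hlt k hk), mul_one]

lemma sm_ultra {H : Type*} [NormedAddCommGroup H] [InnerProductSpace ℝ H]
    [CompleteSpace H] (e : List Bool → H) (he : Orthonormal ℝ e) (p q z : ℕ → Bool)
    (h : inner ℝ (∑' n, smTerm e q n) (∑' n, smTerm e z n) ≤
      (inner ℝ (∑' n, smTerm e p n) (∑' n, smTerm e z n) : ℝ)) :
    inner ℝ (∑' n, smTerm e z n) (∑' n, smTerm e q n) ≤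
      (inner ℝ (∑' n, smTerm e p n) (∑' n, smTerm e q n) : ℝ) := by
  by_cases hpq : p = q
  · subst hpq
    rw [sm_self e he]
    by_cases hz : z = p
    · subst hz; rw [sm_self e he]
    · rw [sm_ne e he _ _ hz]
      have : (0 : ℝ) < 4⁻¹ ^ PiNat.firstDiff z p := by positivity
      linarith
  by_cases hpz : p = z
  · subst hpz; rfl
  by_cases hqz : q = z
  · subst hqz
    rw [sm_self e he, sm_ne e he _ _ hpq] at h
    have : (0 : ℝ) < 4⁻¹ ^ PiNat.firstDiff p q := by positivity
    linarith
  rw [sm_ne e he _ _ hqz, sm_ne e he _ _ hpz] at h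
  rw [sm_ne e he _ _ (Ne.symm hqz), sm_ne e he _ _ hpq]
  have h1 : PiNat.firstDiff q z ≤ PiNat.firstDiff p z := by
    by_contra! hc
    have := pow_lt_pow_right_of_lt_one₀ (a := (4 : ℝ)⁻¹) (by norm_num) (by norm_num) hc
    linarith
  have h2 := PiNat.min_firstDiff_le p z q hpq
  rw [PiNat.firstDiff_comm q z] at h1
  rw [min_eq_right h1] at h2
  have := pow_le_pow_of_le_one (a := (4 : ℝ)⁻¹) (by norm_num) (by norm_num) h2
  linarith

/-- **Example (D. Simmons).** Let `H` be a real Hilbert space and `(e_u)`, indexed by finite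
`±1`-sequences (coded as lists of booleans, `true ↦ 1`, `false ↦ −1`), an orthonormal
family.  Define `π(x) = Σ_n 2^{-n} x(n) e_{x↾n}` and `K = π({−1,1}^ℕ)`.  If `y` lies in the
convex hull of `K ∩ S(y, ρ)` for some `ρ > 0`, then `K ∩ B(y, ρ) = ∅`. -/
theorem simmons_example {H : Type*} [NormedAddCommGroup H] [InnerProductSpace ℝ H]
    [CompleteSpace H] (e : List Bool → H) (he : Orthonormal ℝ e)
    (π : (ℕ → Bool) → H)
    (hπ : ∀ x : ℕ → Bool, π x =
      ∑' n : ℕ, (((2 : ℝ)⁻¹) ^ n * (if x n then 1 else -1)) •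
        e (List.ofFn fun i : Fin n => x i))
    (K : Set H) (hK : K = Set.range π)
    (y : H) (ρ : ℝ) (hρ : 0 < ρ)
    (hy : y ∈ convexHull ℝ (K ∩ Metric.sphere y ρ)) :
    K ∩ Metric.ball y ρ = ∅ := by
  have hπ' : ∀ x, π x = ∑' n, smTerm e x n := hπ
  subst hK
  rw [Set.eq_empty_iff_forall_notMem]
  rintro _ ⟨⟨z, rfl⟩, hz⟩
  rw [convexHull_eq_union_convexHull_finite_subsets] at hy
  simp only [Set.mem_iUnion] at hy
  obtain ⟨t, ht, hyt⟩ := hy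
  have hne : t.Nonempty := by
    have : (convexHull ℝ (t : Set H)).Nonempty := ⟨y, hyt⟩
    simpa using this
  obtain ⟨p, hp, hmax⟩ := t.exists_max_image (fun w => (inner ℝ w (π z) : ℝ)) hne
  have hsub : (t : Set H) ⊆ {w | (innerSL ℝ (π z - p)) w ≤ 0} := by
    intro q hq
    obtain ⟨⟨a, rfl⟩, -⟩ := ht hp
    have hm := hmax q hq
    obtain ⟨⟨b, rfl⟩, -⟩ := ht hq
    simp only [hπ'] at hm
    have := sm_ultra e he a b z hm
    simp only [Set.mem_ofPred_eq, innerSL_apply_apply, inner_sub_left, hπ']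
    linarith
  have hyy := convexHull_min hsub
    (convex_halfSpace_le (innerSL ℝ (π z - p)).toLinearMap.isLinear 0) hyt
  simp only [Set.mem_ofPred_eq, innerSL_apply_apply, inner_sub_left] at hyy
  obtain ⟨⟨a, rfl⟩, hs⟩ := ht hp
  rw [Metric.mem_ball, dist_eq_norm] at hz
  rw [Metric.mem_sphere, dist_eq_norm] at hs
  have e1 := norm_sub_sq_real (π z) y
  have e2 := norm_sub_sq_real (π a) y
  rw [← real_inner_self_eq_norm_sq (π z), hπ' z, sm_self e he, ← hπ'] at e1
  rw [← real_inner_self_eq_norm_sq (π a), hπ' a, sm_self e he, ← hπ', hs] at e2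
  have := norm_nonneg (π z - y)
  nlinarith
end
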